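/- arXiv:2501.10043 — 4 statements merged into one kernel-verified Lean document; each statement's English description precedes it below -/
import Mathlib

section
/- (Lemma 2.2, recursion for P_1.) For all integers m, n ≥ 2, every integer ξ with 3 ≤ ξ ≤ n, and every integer r > 1, one has P_1(m,n,ξ,r) = Σ_{r_1=1}^{r} Σ_{ξ'=1}^{m} C(m−ξ'−1+r_1, r_1−1)·C(ξ−2+r_1, r_1)·P_1(n−ξ+1, m, m−ξ'+1, r−r_1) + h_3(m, n−ξ+1, r). -/
/-- A multiset of pairs of positive integers contains a 2-chain:
two elements (at distinct positions) with both coordinates strictly increasing. -/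
def Has2Chain (S : Multiset (ℕ × ℕ)) : Prop :=
  ∃ a ∈ S, ∃ b ∈ S, a.1 < b.1 ∧ a.2 < b.2

/-- A multiset of pairs contains a 3-chain:
three elements with both coordinates strictly increasing. -/
def Has3Chain (S : Multiset (ℕ × ℕ)) : Prop :=
  ∃ a ∈ S, ∃ b ∈ S, ∃ c ∈ S, a.1 < b.1 ∧ b.1 < c.1 ∧ a.2 < b.2 ∧ b.2 < c.2

/-- The index multiset of a degree-`r` monomial in the variables `z_{i,j}`,
`1 ≤ i ≤ m`, `1 ≤ j ≤ n`, with 1-indexed entries. -/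
def idxMS (m n r : ℕ) (f : Sym (Fin m × Fin n) r) : Multiset (ℕ × ℕ) :=
  Multiset.map (fun p => (p.1.1 + 1, p.2.1 + 1)) (f : Multiset (Fin m × Fin n))

/-- `P1 m n ξ r`: number of degree-`r` monomials in the `m × n` grid of variables
whose index multiset contains no 3-chain and whose part with column index `< ξ`
contains no 2-chain. -/
noncomputable def P1 (m n ξ r : ℕ) : ℕ :=
  Nat.card {f : Sym (Fin m × Fin n) r //
    ¬ Has3Chain (idxMS m n r f) ∧
    ¬ Has2Chain ((idxMS m n r f).filter (fun p => p.2 < ξ)) }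

/-- `h3 m n r`: number of degree-`r` monomials whose index multiset contains no 3-chain. -/
noncomputable def h3 (m n r : ℕ) : ℕ :=
  Nat.card {f : Sym (Fin m × Fin n) r // ¬ Has3Chain (idxMS m n r f) }

/-- Multisets of cardinality `r` all of whose elements lie in `A`. -/
def multisetsIn {α : Type*} (A : Set α) (r : ℕ) : Set (Multiset α) :=
  {S | S.card = r ∧ ∀ x ∈ S, x ∈ A}

theorem multisetsIn_map_bijOn {α β : Type*} {f : α → β} {A : Set α} {B : Set β}
    (h : Set.BijOn f A B) (r : ℕ) :
    Set.BijOn (Multiset.map f) (multisetsIn A r) (multisetsIn B r) := by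
  rcases isEmpty_or_nonempty α with hα | hα
  · have hB : B = ∅ := by
      rw [← h.image_eq, Set.eq_empty_of_isEmpty A, Set.image_empty]
    subst hB
    refine ⟨?_, fun S _ T _ _ => Subsingleton.elim S T, ?_⟩
    · rintro S ⟨hS, -⟩
      exact ⟨by simpa using hS, fun x hx => by
        obtain ⟨y, -, -⟩ := Multiset.mem_map.1 hx
        exact hα.elim y⟩
    · rintro T ⟨hT, hT'⟩
      have : T = 0 := Multiset.eq_zero_of_forall_notMem fun x hx => hT' x hx
      subst this
      exact ⟨0, ⟨by simpa using hT, by simp⟩, by simp⟩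
  · have hinv := h.invOn_invFunOn
    refine Set.InvOn.bijOn (f' := Multiset.map (Function.invFunOn f A)) ⟨?_, ?_⟩ ?_ ?_
    · rintro S ⟨-, hS⟩
      rw [Multiset.map_map]
      exact (Multiset.map_congr rfl fun x hx => hinv.1 (hS x hx)).trans (Multiset.map_id S)
    · rintro S ⟨-, hS⟩
      rw [Multiset.map_map]
      exact (Multiset.map_congr rfl fun x hx => hinv.2 (hS x hx)).trans (Multiset.map_id S)
    · rintro S ⟨hr, hS⟩
      refine ⟨by simpa using hr, fun x hx => ?_⟩
      obtain ⟨y, hy, rfl⟩ := Multiset.mem_map.1 hx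
      exact h.mapsTo (hS y hy)
    · rintro S ⟨hr, hS⟩
      refine ⟨by simpa using hr, fun x hx => ?_⟩
      obtain ⟨y, hy, rfl⟩ := Multiset.mem_map.1 hx
      exact h.surjOn.mapsTo_invFunOn (hS y hy)

theorem ncard_multisetsIn_congr {α β : Type*} {f : α → β} {A : Set α} {B : Set β}
    (h : Set.BijOn f A B) (r : ℕ) {Q : Multiset α → Prop} {Q' : Multiset β → Prop}
    (hQ : ∀ S ∈ multisetsIn A r, (Q S ↔ Q' (S.map f))) :
    {S ∈ multisetsIn A r | Q S}.ncard = {T ∈ multisetsIn B r | Q' T}.ncard := by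
  have hb := multisetsIn_map_bijOn h r
  refine Set.BijOn.ncard_eq (f := Multiset.map f) ⟨?_, ?_, ?_⟩
  · rintro S ⟨hS, hS'⟩
    exact ⟨hb.mapsTo hS, (hQ S hS).1 hS'⟩
  · exact hb.injOn.mono fun S hS => hS.1
  · rintro T ⟨hT, hT'⟩
    obtain ⟨S, hS, rfl⟩ := hb.surjOn hT
    exact ⟨S, ⟨hS, (hQ S hS).2 hT'⟩, rfl⟩

theorem subtypeVal_bijOn {α : Type*} (A : Set α) :
    Set.BijOn ((↑) : A → α) Set.univ A :=
  ⟨fun x _ => x.2, Subtype.val_injective.injOn, fun x hx => ⟨⟨x, hx⟩, trivial, rfl⟩⟩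

theorem finite_multisetsIn {α : Type*} {A : Set α} (hA : A.Finite) (r : ℕ) :
    (multisetsIn A r).Finite := by
  classical
  have := hA.fintype
  have hb := multisetsIn_map_bijOn (f := ((↑) : A → α)) (A := Set.univ) (B := A)
    (subtypeVal_bijOn A) r
  rw [← hb.finite_iff_finite]
  exact (Set.finite_range (fun s : Sym A r => (s : Multiset A))).subset
    fun S hS => ⟨⟨S, hS.1⟩, rfl⟩

theorem ncard_multisetsIn {α : Type*} {A : Set α} (hA : A.Finite) (r : ℕ) :
    (multisetsIn A r).ncard = A.ncard.multichoose r := by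
  classical
  have := hA.fintype
  have hb := multisetsIn_map_bijOn (f := ((↑) : A → α)) (A := Set.univ) (B := A)
    (subtypeVal_bijOn A) r
  rw [← hb.ncard_eq, ← Nat.card_coe_set_eq A, Nat.card_eq_fintype_card,
    ← Sym.card_sym_eq_multichoose, ← Nat.card_eq_fintype_card, ← Nat.card_coe_set_eq]
  exact Nat.card_congr (Equiv.subtypeEquivRight fun S => by simp [multisetsIn])

/-- The integer box `[1, m] × [a, b]`. -/
def box (m a b : ℕ) : Set (ℕ × ℕ) := Set.Icc 1 m ×ˢ Set.Icc a b

theorem mem_box {m a b : ℕ} {p : ℕ × ℕ} :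
    p ∈ box m a b ↔ (1 ≤ p.1 ∧ p.1 ≤ m) ∧ a ≤ p.2 ∧ p.2 ≤ b := Iff.rfl

theorem finite_box (m a b : ℕ) : (box m a b).Finite :=
  (Set.finite_Icc _ _).prod (Set.finite_Icc _ _)

theorem card_sym_idxMS (m n r : ℕ) (Q : Multiset (ℕ × ℕ) → Prop) :
    Nat.card {f : Sym (Fin m × Fin n) r // Q (idxMS m n r f)} =
      {S ∈ multisetsIn (box m 1 n) r | Q S}.ncard := by
  have hb : Set.BijOn (fun p : Fin m × Fin n => (p.1.1 + 1, p.2.1 + 1)) Set.univ (box m 1 n) := by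
    refine ⟨?_, ?_, ?_⟩
    · rintro ⟨⟨i, hi⟩, ⟨j, hj⟩⟩ -
      rw [mem_box]
      dsimp only
      omega
    · rintro ⟨⟨i, hi⟩, ⟨j, hj⟩⟩ - ⟨⟨i', hi'⟩, ⟨j', hj'⟩⟩ - h
      simpa using h
    · rintro ⟨i, j⟩ h
      rw [mem_box] at h
      dsimp only at h
      refine ⟨(⟨i - 1, by omega⟩, ⟨j - 1, by omega⟩), trivial, ?_⟩
      ext <;> dsimp only <;> omega
  rw [← ncard_multisetsIn_congr hb r (Q := fun S => Q (S.map _)) fun S _ => Iff.rfl,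
    ← Nat.card_coe_set_eq]
  refine Nat.card_congr ⟨fun f => ⟨f.1.1, ⟨f.1.2, fun _ _ => trivial⟩, f.2⟩,
    fun S => ⟨⟨S.1, S.2.1.1⟩, S.2.2⟩, fun f => rfl, fun S => rfl⟩

theorem P1_eq_ncard (m n ξ r : ℕ) :
    P1 m n ξ r = {S ∈ multisetsIn (box m 1 n) r |
      ¬ Has3Chain S ∧ ¬ Has2Chain (S.filter fun p => p.2 < ξ)}.ncard :=
  card_sym_idxMS m n r fun S => ¬ Has3Chain S ∧ ¬ Has2Chain (S.filter fun p => p.2 < ξ)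

theorem h3_eq_ncard (m n r : ℕ) :
    h3 m n r = {S ∈ multisetsIn (box m 1 n) r | ¬ Has3Chain S}.ncard :=
  card_sym_idxMS m n r fun S => ¬ Has3Chain S

theorem h3_eq_ncard_box (m n ξ r : ℕ) (hξ : 1 ≤ ξ) (hξn : ξ ≤ n) :
    h3 m (n - ξ + 1) r = {S ∈ multisetsIn (box m ξ n) r | ¬ Has3Chain S}.ncard := by
  rw [h3_eq_ncard]
  refine ncard_multisetsIn_congr (f := fun p => (p.1, p.2 + (ξ - 1))) ⟨?_, ?_, ?_⟩ r ?_
  · rintro ⟨i, j⟩ h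
    rw [mem_box] at h ⊢
    dsimp only at h ⊢
    omega
  · rintro ⟨i, j⟩ - ⟨i', j'⟩ - h
    simpa using h
  · rintro ⟨i, j⟩ h
    rw [mem_box] at h
    dsimp only at h
    refine ⟨(i, j - (ξ - 1)), ?_, ?_⟩
    · rw [mem_box]
      dsimp only
      omega
    · ext <;> dsimp only
      omega
  · intro S _
    simp [Has3Chain]

theorem ncard_right_eq_P1 (m n ξ k r : ℕ) (hξ : 1 ≤ ξ) (hξn : ξ ≤ n) (hk : k ≤ m) :
    {S ∈ multisetsIn (box m ξ n) r |
      ¬ Has3Chain S ∧ ¬ Has2Chain (S.filter fun p => k < p.1)}.ncard =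
      P1 (n - ξ + 1) m (m - k + 1) r := by
  rw [P1_eq_ncard]
  refine ncard_multisetsIn_congr (f := fun p => (n + 1 - p.2, m + 1 - p.1)) ⟨?_, ?_, ?_⟩ r ?_
  · rintro ⟨i, j⟩ h
    rw [mem_box] at h ⊢
    dsimp only at h ⊢
    omega
  · rintro ⟨i, j⟩ h ⟨i', j'⟩ h' he
    rw [mem_box] at h h'
    simp only [Prod.mk.injEq] at he ⊢
    dsimp only at h h'
    omega
  · rintro ⟨i, j⟩ h
    rw [mem_box] at h
    dsimp only at h
    refine ⟨(m + 1 - j, n + 1 - i), ?_, ?_⟩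
    · rw [mem_box]
      dsimp only
      omega
    · ext <;> dsimp only <;> omega
  · rintro S ⟨-, hS⟩
    simp only [mem_box] at hS
    refine and_congr (not_congr ⟨?_, ?_⟩) (not_congr ⟨?_, ?_⟩)
    · rintro ⟨a, ha, b, hb, c, hc, h⟩
      have := hS a ha
      have := hS b hb
      have := hS c hc
      refine ⟨_, Multiset.mem_map_of_mem _ hc, _, Multiset.mem_map_of_mem _ hb, _,
        Multiset.mem_map_of_mem _ ha, ?_⟩
      dsimp only
      omega
    · rintro ⟨a, ha, b, hb, c, hc, h⟩
      obtain ⟨a, haS, rfl⟩ := Multiset.mem_map.1 ha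
      obtain ⟨b, hbS, rfl⟩ := Multiset.mem_map.1 hb
      obtain ⟨c, hcS, rfl⟩ := Multiset.mem_map.1 hc
      dsimp only at h
      have := hS a haS
      have := hS b hbS
      have := hS c hcS
      exact ⟨c, hcS, b, hbS, a, haS, by omega⟩
    · rintro ⟨a, ha, b, hb, h⟩
      rw [Multiset.mem_filter] at ha hb
      have := hS a ha.1
      have := hS b hb.1
      refine ⟨_, Multiset.mem_filter.2 ⟨Multiset.mem_map_of_mem _ hb.1, ?_⟩, _,
        Multiset.mem_filter.2 ⟨Multiset.mem_map_of_mem _ ha.1, ?_⟩, ?_⟩ <;> dsimp only <;> omega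
    · rintro ⟨a, ha, b, hb, h⟩
      obtain ⟨ha, ha'⟩ := Multiset.mem_filter.1 ha
      obtain ⟨hb, hb'⟩ := Multiset.mem_filter.1 hb
      obtain ⟨a, haS, rfl⟩ := Multiset.mem_map.1 ha
      obtain ⟨b, hbS, rfl⟩ := Multiset.mem_map.1 hb
      dsimp only at h ha' hb'
      exact ⟨b, Multiset.mem_filter.2 ⟨hbS, by omega⟩, a, Multiset.mem_filter.2 ⟨haS, by omega⟩,
        by omega⟩

/-- Lexicographic order on pairs, increasing in the first coordinate and decreasing in the
second. -/
def RowColLE (p q : ℕ × ℕ) : Prop := p.1 < q.1 ∨ (p.1 = q.1 ∧ q.2 ≤ p.2)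

theorem eq_zip_sort_of_not_has2Chain {S : Multiset (ℕ × ℕ)} (hS : ¬ Has2Chain S) :
    S = (((S.map Prod.fst).sort (· ≤ ·)).zip ((S.map Prod.snd).sort (· ≥ ·)) :
      List (ℕ × ℕ)) := by
  classical
  have : IsTrans _ RowColLE := ⟨fun a b c => by unfold RowColLE; omega⟩
  have : Std.Antisymm RowColLE := ⟨fun a b h h' => by
    unfold RowColLE at h h'
    ext <;> omega⟩
  have : Std.Total RowColLE := ⟨fun a b => by unfold RowColLE; omega⟩
  obtain ⟨l, hl, rfl⟩ : ∃ l : List (ℕ × ℕ), l.Pairwise RowColLE ∧ (l : Multiset (ℕ × ℕ)) = S :=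
    ⟨S.sort RowColLE, S.pairwise_sort RowColLE, S.sort_eq RowColLE⟩
  have h₁ : (Multiset.map Prod.fst (l : Multiset (ℕ × ℕ))).sort (· ≤ ·) = l.map Prod.fst := by
    rw [Multiset.map_coe, Multiset.coe_sort]
    refine List.mergeSort_eq_self _ (List.pairwise_map.2 (hl.imp fun h => ?_))
    unfold RowColLE at h
    omega
  have h₂ : (Multiset.map Prod.snd (l : Multiset (ℕ × ℕ))).sort (· ≥ ·) = l.map Prod.snd := by
    rw [Multiset.map_coe, Multiset.coe_sort]
    refine List.mergeSort_eq_self _ (List.pairwise_map.2 (hl.imp_of_mem fun {a b} ha hb h => ?_))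
    unfold RowColLE at h
    by_contra hlt
    exact hS ⟨a, ha, b, hb, by omega, by omega⟩
  rw [h₁, h₂, ← List.zip_of_prod (xs := l) rfl rfl]

theorem not_has2Chain_zip {l₁ l₂ : List ℕ} (h₁ : l₁.Pairwise (· ≤ ·)) (h₂ : l₂.Pairwise (· ≥ ·)) :
    ¬ Has2Chain (l₁.zip l₂ : List (ℕ × ℕ)) := by
  rintro ⟨a, ha, b, hb, h⟩
  obtain ⟨i, hi, rfl⟩ := List.mem_iff_getElem.1 (Multiset.mem_coe.1 ha)
  obtain ⟨j, hj, rfl⟩ := List.mem_iff_getElem.1 (Multiset.mem_coe.1 hb)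
  rw [List.length_zip] at hi hj
  simp only [List.getElem_zip] at h
  rcases lt_trichotomy i j with hij | rfl | hij
  · have := List.pairwise_iff_getElem.1 h₂ i j (by omega) (by omega) hij
    omega
  · omega
  · have := List.pairwise_iff_getElem.1 h₁ j i (by omega) (by omega) hij
    omega

theorem bijOn_map_fst_map_snd (r : ℕ) :
    Set.BijOn (fun S : Multiset (ℕ × ℕ) => (S.map Prod.fst, S.map Prod.snd))
      {S | S.card = r ∧ ¬ Has2Chain S} {R | R.1.card = r ∧ R.2.card = r} := by
  refine ⟨?_, ?_, ?_⟩
  · rintro S ⟨hS, -⟩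
    simpa using hS
  · rintro S ⟨-, hS⟩ T ⟨-, hT⟩ h
    obtain ⟨h₁, h₂⟩ := Prod.mk.inj h
    rw [eq_zip_sort_of_not_has2Chain hS, eq_zip_sort_of_not_has2Chain hT, h₁, h₂]
  · rintro ⟨R, C⟩ ⟨hR, hC⟩
    dsimp only at hR hC
    have hl : (R.sort (· ≤ ·)).length = (C.sort (· ≥ ·)).length := by
      rw [Multiset.length_sort, Multiset.length_sort, hR, hC]
    refine ⟨((R.sort (· ≤ ·)).zip (C.sort (· ≥ ·)) : List (ℕ × ℕ)), ⟨?_, ?_⟩, ?_⟩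
    · rw [Multiset.coe_card, List.length_zip, ← hl, min_self, Multiset.length_sort, hR]
    · exact not_has2Chain_zip (Multiset.pairwise_sort _ _) (Multiset.pairwise_sort _ _)
    · simp only [Multiset.map_coe]
      rw [List.map_fst_zip hl.le, List.map_snd_zip hl.ge, Multiset.sort_eq, Multiset.sort_eq]

theorem ncard_multisetsIn_Icc_least (k m r : ℕ) (hkm : k ≤ m) (hk : 1 ≤ k) (hr : 1 ≤ r) :
    {R ∈ multisetsIn (Set.Icc 1 m) r | k ∈ R ∧ ∀ i ∈ R, k ≤ i}.ncard =
      (m - k + 1).multichoose (r - 1) := by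
  have hb : Set.BijOn (Multiset.cons k) (multisetsIn (Set.Icc k m) (r - 1))
      {R ∈ multisetsIn (Set.Icc 1 m) r | k ∈ R ∧ ∀ i ∈ R, k ≤ i} := by
    refine ⟨?_, fun S _ T _ h => (Multiset.cons_inj_right k).1 h, ?_⟩
    · rintro S ⟨hc, hS⟩
      refine ⟨⟨by rw [Multiset.card_cons]; omega, ?_⟩, Multiset.mem_cons_self _ _, ?_⟩
      · intro i hi
        rcases Multiset.mem_cons.1 hi with rfl | hi
        · exact ⟨hk, hkm⟩
        · exact ⟨hk.trans (hS i hi).1, (hS i hi).2⟩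
      · intro i hi
        rcases Multiset.mem_cons.1 hi with rfl | hi
        · exact le_rfl
        · exact (hS i hi).1
    · rintro R ⟨⟨hc, hR⟩, hkR, hle⟩
      obtain ⟨S, rfl⟩ := Multiset.exists_cons_of_mem hkR
      rw [Multiset.card_cons] at hc
      exact ⟨S, ⟨by omega, fun i hi => ⟨hle i (Multiset.mem_cons_of_mem hi),
        (hR i (Multiset.mem_cons_of_mem hi)).2⟩⟩, rfl⟩
  rw [← hb.ncard_eq, ncard_multisetsIn (Set.finite_Icc _ _), Set.ncard_eq_toFinset_card']
  congr 1
  simp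
  omega

/-- Counting `2`-chain free multisets in a box with prescribed smallest row. -/
theorem ncard_left (k m b r : ℕ) (hkm : k ≤ m) (hk : 1 ≤ k) (hr : 1 ≤ r) :
    {S ∈ multisetsIn (box m 1 b) r |
      ¬ Has2Chain S ∧ (∃ p ∈ S, p.1 = k) ∧ ∀ p ∈ S, k ≤ p.1}.ncard =
      (m - k + 1).multichoose (r - 1) * b.multichoose r := by
  rw [← ncard_multisetsIn_Icc_least k m r hkm hk hr]
  have hb : (multisetsIn (Set.Icc 1 b) r).ncard = b.multichoose r := by
    rw [ncard_multisetsIn (Set.finite_Icc _ _), Set.ncard_eq_toFinset_card']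
    simp
  rw [← hb, ← Set.ncard_prod]
  have hbij := bijOn_map_fst_map_snd r
  refine Set.BijOn.ncard_eq (f := fun S : Multiset (ℕ × ℕ) => (S.map Prod.fst, S.map Prod.snd))
    ⟨?_, hbij.injOn.mono ?_, ?_⟩
  · rintro S ⟨⟨hc, hS⟩, -, ⟨p, hp, rfl⟩, hle⟩
    refine ⟨⟨⟨by simpa using hc, ?_⟩, Multiset.mem_map_of_mem _ hp, ?_⟩, by simpa using hc, ?_⟩
    · intro i hi
      obtain ⟨q, hq, rfl⟩ := Multiset.mem_map.1 hi
      exact (hS q hq).1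
    · intro i hi
      obtain ⟨q, hq, rfl⟩ := Multiset.mem_map.1 hi
      exact hle q hq
    · intro i hi
      obtain ⟨q, hq, rfl⟩ := Multiset.mem_map.1 hi
      exact (hS q hq).2
  · rintro S ⟨⟨hc, -⟩, h2, -⟩
    exact ⟨hc, h2⟩
  · rintro ⟨R, C⟩ ⟨⟨⟨hcR, hR⟩, hkR, hle⟩, hcC, hC⟩
    obtain ⟨S, ⟨hc, hS⟩, h⟩ := hbij.surjOn
      (show (R, C) ∈ {P : Multiset ℕ × Multiset ℕ | P.1.card = r ∧ P.2.card = r} from ⟨hcR, hcC⟩)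
    obtain ⟨rfl, rfl⟩ := Prod.mk.inj h
    exact ⟨S, ⟨⟨hc, fun p hp => ⟨hR _ (Multiset.mem_map_of_mem _ hp),
      hC _ (Multiset.mem_map_of_mem _ hp)⟩⟩, hS, Multiset.mem_map.1 hkR,
      fun p hp => hle _ (Multiset.mem_map_of_mem _ hp)⟩, rfl⟩

theorem not_has3Chain_add_iff {A B : Multiset (ℕ × ℕ)} {ξ k : ℕ} (hA : ∀ p ∈ A, p.2 < ξ)
    (hB : ∀ p ∈ B, ξ ≤ p.2) (hA2 : ¬ Has2Chain A) (hk : ∃ p ∈ A, p.1 = k)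
    (hle : ∀ p ∈ A, k ≤ p.1) :
    ¬ Has3Chain (A + B) ↔ ¬ Has3Chain B ∧ ¬ Has2Chain (B.filter fun p => k < p.1) := by
  rw [← not_or, not_iff_not]
  constructor
  · rintro ⟨a, ha, b, hb, c, hc, h⟩
    rw [Multiset.mem_add] at ha hb hc
    have hbB : b ∈ B := hb.resolve_left fun hb => by
      have := hA b hb
      exact hA2 ⟨a, ha.resolve_right fun ha => by have := hB a ha; omega, b, hb, by omega⟩
    have hcB : c ∈ B := hc.resolve_left fun hc => by
      have := hA c hc
      have := hB b hbB
      omega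
    rcases ha with ha | ha
    · have := hle a ha
      exact Or.inr ⟨b, Multiset.mem_filter.2 ⟨hbB, by omega⟩, c,
        Multiset.mem_filter.2 ⟨hcB, by omega⟩, by omega⟩
    · exact Or.inl ⟨a, ha, b, hbB, c, hcB, h⟩
  · rintro (⟨a, ha, b, hb, c, hc, h⟩ | ⟨b, hb, c, hc, h⟩)
    · exact ⟨a, Multiset.mem_add.2 (Or.inr ha), b, Multiset.mem_add.2 (Or.inr hb), c,
        Multiset.mem_add.2 (Or.inr hc), h⟩
    · obtain ⟨p, hp, rfl⟩ := hk
      rw [Multiset.mem_filter] at hb hc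
      have := hA p hp
      have := hB b hb.1
      exact ⟨p, Multiset.mem_add.2 (Or.inl hp), b, Multiset.mem_add.2 (Or.inr hb.1), c,
        Multiset.mem_add.2 (Or.inr hc.1), by omega⟩

/-- The smallest row index occurring in `S` (and `0` when `S` is empty). -/
noncomputable def minRow (S : Multiset (ℕ × ℕ)) : ℕ := sInf {i | ∃ p ∈ S, p.1 = i}

theorem minRow_eq_iff {S : Multiset (ℕ × ℕ)} (hS : S ≠ 0) (k : ℕ) :
    minRow S = k ↔ (∃ p ∈ S, p.1 = k) ∧ ∀ p ∈ S, k ≤ p.1 := by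
  obtain ⟨q, hq⟩ := Multiset.exists_mem_of_ne_zero hS
  constructor
  · rintro rfl
    exact ⟨Nat.sInf_mem (s := {i | ∃ p ∈ S, p.1 = i}) ⟨q.1, q, hq, rfl⟩,
      fun p hp => Nat.sInf_le ⟨p, hp, rfl⟩⟩
  · rintro ⟨hk, hle⟩
    refine le_antisymm (Nat.sInf_le hk) (le_csInf ⟨q.1, q, hq, rfl⟩ ?_)
    rintro i ⟨p, hp, rfl⟩
    exact hle p hp

theorem ncard_eq_sum_ncard_fiber {α β : Type*} {X : Set α} (hX : X.Finite) (f : α → β)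
    (t : Finset β) (hf : ∀ x ∈ X, f x ∈ t) :
    X.ncard = ∑ b ∈ t, {x ∈ X | f x = b}.ncard := by
  classical
  rw [Set.ncard_eq_toFinset_card X hX, Finset.card_eq_sum_card_fiberwise (f := f) (t := t)
    fun x hx => hf x (hX.mem_toFinset.1 hx)]
  refine Finset.sum_congr rfl fun b _ => ?_
  rw [← Set.ncard_coe_finset]
  congr 1
  ext x
  simp

theorem filter_add_of_lt_of_le {A B : Multiset (ℕ × ℕ)} {ξ : ℕ} (hA : ∀ p ∈ A, p.2 < ξ)
    (hB : ∀ p ∈ B, ξ ≤ p.2) :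
    (A + B).filter (fun p => p.2 < ξ) = A := by
  rw [Multiset.filter_add, Multiset.filter_eq_self.2 hA,
    Multiset.filter_eq_nil.2 fun p hp => (hB p hp).not_gt, add_zero]

theorem ncard_fiber (m n ξ r r₁ k : ℕ) (hξ : 1 ≤ ξ) (hξn : ξ ≤ n) (hr₁ : 1 ≤ r₁) (hr : r₁ ≤ r) :
    {S ∈ multisetsIn (box m 1 n) r |
      (¬ Has3Chain S ∧ ¬ Has2Chain (S.filter fun p => p.2 < ξ)) ∧
      (S.filter fun p => p.2 < ξ).card = r₁ ∧ minRow (S.filter fun p => p.2 < ξ) = k}.ncard =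
    {S ∈ multisetsIn (box m 1 (ξ - 1)) r₁ |
      ¬ Has2Chain S ∧ (∃ p ∈ S, p.1 = k) ∧ ∀ p ∈ S, k ≤ p.1}.ncard *
    {S ∈ multisetsIn (box m ξ n) (r - r₁) |
      ¬ Has3Chain S ∧ ¬ Has2Chain (S.filter fun p => k < p.1)}.ncard := by
  rw [← Set.ncard_prod]
  symm
  have hlt : ∀ {A : Multiset (ℕ × ℕ)}, A ∈ multisetsIn (box m 1 (ξ - 1)) r₁ →
      ∀ p ∈ A, p.2 < ξ := fun hA p hp => by
    have := mem_box.1 (hA.2 p hp)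
    omega
  have hle : ∀ {B : Multiset (ℕ × ℕ)}, B ∈ multisetsIn (box m ξ n) (r - r₁) →
      ∀ p ∈ B, ξ ≤ p.2 := fun hB p hp => (hB.2 p hp).2.1
  refine Set.BijOn.ncard_eq
    (f := fun P : Multiset (ℕ × ℕ) × Multiset (ℕ × ℕ) => P.1 + P.2) ⟨?_, ?_, ?_⟩
  · rintro ⟨A, B⟩ ⟨⟨hA, hA2, hk, hkle⟩, hB, hB'⟩
    dsimp only at hA hA2 hk hkle hB hB' ⊢
    have hf := filter_add_of_lt_of_le (hlt hA) (hle hB)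
    have hA0 : A ≠ 0 := by
      rw [← Multiset.card_pos, hA.1]
      exact hr₁
    refine ⟨⟨?_, ?_⟩, ⟨?_, ?_⟩, ?_⟩
    · rw [Multiset.card_add, hA.1, hB.1]
      omega
    · intro p hp
      rw [mem_box]
      rcases Multiset.mem_add.1 hp with hp | hp
      · have := mem_box.1 (hA.2 p hp)
        omega
      · have := mem_box.1 (hB.2 p hp)
        omega
    · exact (not_has3Chain_add_iff (hlt hA) (hle hB) hA2 hk hkle).2 hB'
    · rwa [hf]
    · rw [hf]
      exact ⟨hA.1, (minRow_eq_iff hA0 k).2 ⟨hk, hkle⟩⟩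
  · rintro ⟨A, B⟩ ⟨⟨hA, -⟩, hB, -⟩ ⟨A', B'⟩ ⟨⟨hA', -⟩, hB', -⟩ h
    dsimp only at hA hB hA' hB' h
    have hAA : A = A' := by
      rw [← filter_add_of_lt_of_le (hlt hA) (hle hB), h,
        filter_add_of_lt_of_le (hlt hA') (hle hB')]
    subst hAA
    rw [add_left_cancel h]
  · rintro S ⟨⟨hc, hS⟩, ⟨h3, h2⟩, hc₁, hk⟩
    have hadd := Multiset.filter_add_not (fun p : ℕ × ℕ => p.2 < ξ) S
    have hA0 : S.filter (fun p => p.2 < ξ) ≠ 0 := by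
      rw [← Multiset.card_pos, hc₁]
      exact hr₁
    have hmin := (minRow_eq_iff hA0 k).1 hk
    have hA : ∀ p ∈ S.filter (fun p => p.2 < ξ), p.2 < ξ := fun p hp =>
      (Multiset.mem_filter.1 hp).2
    have hB : ∀ p ∈ S.filter (fun p => ¬ p.2 < ξ), ξ ≤ p.2 :=
      fun p hp => not_lt.1 (Multiset.mem_filter.1 hp).2
    refine ⟨(S.filter fun p => p.2 < ξ, S.filter fun p => ¬ p.2 < ξ),
      ⟨⟨⟨hc₁, fun p hp => ?_⟩, h2, hmin⟩, ⟨?_, fun p hp => ?_⟩, ?_⟩, hadd⟩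
    · have := mem_box.1 (hS p (Multiset.mem_of_mem_filter hp))
      have := hA p hp
      rw [mem_box]
      omega
    · have := congrArg Multiset.card hadd
      rw [Multiset.card_add] at this
      dsimp only
      omega
    · have := mem_box.1 (hS p (Multiset.mem_of_mem_filter hp))
      have := hB p hp
      rw [mem_box]
      omega
    · refine (not_has3Chain_add_iff hA hB h2 hmin.1 hmin.2).1 ?_
      rwa [hadd]

/-- Lemma 2.2 of the paper: the recursion formula for `P1`. -/
theorem P1_recursion (m n ξ r : ℕ) (hm : 2 ≤ m) (hn : 2 ≤ n)
    (hξ : 3 ≤ ξ) (hξn : ξ ≤ n) (hr : 1 < r) :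
    P1 m n ξ r =
      (∑ r₁ ∈ Finset.Icc 1 r, ∑ ξ' ∈ Finset.Icc 1 m,
        Nat.choose (m + r₁ - ξ' - 1) (r₁ - 1) * Nat.choose (ξ - 2 + r₁) r₁ *
          P1 (n - ξ + 1) m (m - ξ' + 1) (r - r₁))
        + h3 m (n - ξ + 1) r := by
  have hfin : ∀ Q : Multiset (ℕ × ℕ) → Prop, {S ∈ multisetsIn (box m 1 n) r | Q S}.Finite :=
    fun Q => (finite_multisetsIn (finite_box m 1 n) r).subset (Set.sep_subset _ _)
  rw [P1_eq_ncard, ncard_eq_sum_ncard_fiber (hfin _)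
    (fun S => (S.filter fun p => p.2 < ξ).card) (insert 0 (Finset.Icc 1 r)) ?_,
    Finset.sum_insert (by simp), add_comm]
  · congr 1
    · refine Finset.sum_congr rfl fun r₁ hr₁ => ?_
      rw [Finset.mem_Icc] at hr₁
      rw [ncard_eq_sum_ncard_fiber ((hfin _).subset (Set.sep_subset _ _))
        (fun S => minRow (S.filter fun p => p.2 < ξ)) (Finset.Icc 1 m) ?_]
      · refine Finset.sum_congr rfl fun k hk => ?_
        rw [Finset.mem_Icc] at hk
        rw [← ncard_right_eq_P1 m n ξ k (r - r₁) (by omega) hξn hk.2,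
          show m + r₁ - k - 1 = m - k + 1 + (r₁ - 1) - 1 by omega, ← Nat.multichoose_eq,
          show ξ - 2 + r₁ = ξ - 1 + r₁ - 1 by omega, ← Nat.multichoose_eq,
          ← ncard_left k m (ξ - 1) r₁ hk.2 hk.1 hr₁.1,
          ← ncard_fiber m n ξ r r₁ k (by omega) hξn hr₁.1 hr₁.2]
        congr 1
        ext S
        simp only [Set.mem_ofPred_eq, and_assoc]
      · rintro S ⟨⟨⟨-, hS⟩, -⟩, hc⟩
        obtain ⟨⟨p, hp, hpk⟩, -⟩ := (minRow_eq_iff (S := S.filter fun p => p.2 < ξ)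
          (by rw [← Multiset.card_pos]; omega) _).1 rfl
        rw [← hpk, Finset.mem_Icc]
        exact (hS p (Multiset.mem_of_mem_filter hp)).1
    · rw [h3_eq_ncard_box m n ξ r (by omega) hξn]
      congr 1
      ext S
      simp only [Set.mem_ofPred_eq, Multiset.card_eq_zero, Multiset.filter_eq_nil, not_lt]
      constructor
      · rintro ⟨⟨⟨hc, hS⟩, h3, -⟩, hle⟩
        exact ⟨⟨hc, fun p hp => ⟨(hS p hp).1, hle p hp, (hS p hp).2.2⟩⟩, h3⟩
      · rintro ⟨⟨hc, hS⟩, h3⟩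
        have hle : ∀ p ∈ S, ξ ≤ p.2 := fun p hp => (hS p hp).2.1
        refine ⟨⟨⟨hc, fun p hp => ⟨(hS p hp).1, ?_, (hS p hp).2.2⟩⟩, h3, ?_⟩, fun p hp => hle p hp⟩
        · have := hle p hp
          omega
        · rintro ⟨p, hp, -⟩
          have := Multiset.mem_filter.1 hp
          have := hle p this.1
          omega
  · rintro S ⟨⟨hc, -⟩, -⟩
    have := Multiset.card_le_card (Multiset.filter_le (fun p : ℕ × ℕ => p.2 < ξ) S)
    rw [Finset.mem_insert, Finset.mem_Icc]
    omega
end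

section
/- (Corollary 2.1, degree of P_1.) For all integers m, n ≥ 2 and every integer ξ with 1 ≤ ξ ≤ n, there exists a polynomial p ∈ ℚ[r] such that P_1(m,n,ξ,r) = p(r) for all sufficiently large natural numbers r, and the degree of p equals 2m+2n−5 if ξ = 1, and equals 2m+2n−ξ−3 if ξ ≥ 2. -/
open Finset Polynomial in
theorem card_sym_toFinset_eq {α : Type*} [Fintype α] [DecidableEq α] (F : Finset α) {r : ℕ}
    (h : #F ≤ r) :
    #{f : Sym α r | (f : Multiset α).toFinset = F} = Nat.multichoose #F (r - #F) := by
  have hcard : Nat.multichoose #F (r - #F) = #(univ : Finset (Sym F (r - #F))) := by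
    rw [Finset.card_univ, Sym.card_sym_eq_multichoose, Fintype.card_coe]
  rw [hcard]
  symm
  refine Finset.card_bij
    (fun t _ ↦ Sym.mk ((t : Multiset F).map Subtype.val + F.val) ?_) ?_ ?_ ?_
  · have := t.2
    simp only [Multiset.card_add, Multiset.card_map, Finset.card_val]
    change Multiset.card t.1 + _ = _
    omega
  · intro t _
    simp only [mem_filter, mem_univ, true_and]
    ext a
    simp only [Sym.coe_mk, Multiset.mem_toFinset, Multiset.mem_add, Multiset.mem_map,
      Finset.mem_val]
    constructor
    · rintro (⟨b, -, rfl⟩ | ha)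
      · exact b.2
      · exact ha
    · exact Or.inr
  · intro t _ u _ htu
    have h1 := congrArg Subtype.val htu
    exact Sym.coe_injective (Multiset.map_injective Subtype.val_injective (add_right_cancel h1))
  · intro f hf
    simp only [mem_filter, mem_univ, true_and] at hf
    have hle : F.val ≤ (f : Multiset α) := by
      rw [Multiset.le_iff_subset F.nodup]
      intro a ha
      rw [← Multiset.mem_toFinset, hf]
      exact ha
    have hmem : ∀ a ∈ (f : Multiset α) - F.val, a ∈ F := by
      intro a ha
      rw [← hf, Multiset.mem_toFinset]
      exact Multiset.mem_of_le (Multiset.sub_le_self _ _) ha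
    obtain ⟨t, ht⟩ : ∃ t : Multiset F, t.map Subtype.val = (f : Multiset α) - F.val :=
      ⟨((f : Multiset α) - F.val).attach.map fun a ↦ ⟨a.1, hmem a.1 a.2⟩, by
        simp [Multiset.map_map]⟩
    have hc : Multiset.card t = r - #F := by
      rw [← Multiset.card_map Subtype.val t, ht, Multiset.card_sub hle, Finset.card_val]
      congr 1
      exact f.2
    refine ⟨Sym.mk t hc, mem_univ _, ?_⟩
    apply Sym.coe_injective
    change t.map Subtype.val + F.val = (f : Multiset α)
    rw [ht, tsub_add_cancel_of_le hle]

open Finset Polynomial in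
theorem exists_polynomial_card_sym_of_toFinset {α : Type*} [Fintype α] [DecidableEq α]
    (Q : Finset α → Prop) {d : ℕ} (hle : ∀ F, Q F → #F ≤ d + 1) (hex : ∃ F, Q F ∧ #F = d + 1) :
    ∃ p : ℚ[X],
      (∀ᶠ r in Filter.atTop,
        (Nat.card {f : Sym α r // Q (f : Multiset α).toFinset} : ℚ) = p.eval (r : ℚ)) ∧
      p.natDegree = d := by
  classical
  set S : Finset (Finset α) := {F | Q F ∧ F.Nonempty} with hS
  have hmem : ∀ F ∈ S, 0 < #F ∧ #F ≤ d + 1 := fun F hF ↦ by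
    simp only [hS, mem_filter, mem_univ, true_and] at hF
    exact ⟨hF.2.card_pos, hle F hF.1⟩
  refine ⟨∑ F ∈ S, preHilbertPoly ℚ (#F - 1) #F, ?_, ?_⟩
  · filter_upwards [Filter.eventually_ge_atTop (Fintype.card α + 1)] with r hr
    have hmaps : ((univ.filter fun f : Sym α r ↦ Q (f : Multiset α).toFinset) : Set (Sym α r)).MapsTo
        (fun f : Sym α r ↦ (f : Multiset α).toFinset) S := by
      intro f hf
      simp only [coe_filter, mem_univ, true_and, Set.mem_ofPred_eq] at hf
      simp only [hS, coe_filter, mem_univ, true_and, Set.mem_ofPred_eq]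
      refine ⟨hf, ?_⟩
      rw [Multiset.toFinset_nonempty, ← Multiset.card_pos]
      have : Multiset.card (f : Multiset α) = r := f.2
      omega
    rw [Nat.card_eq_fintype_card, Fintype.card_subtype, card_eq_sum_card_fiberwise hmaps,
      eval_finsetSum, Nat.cast_sum]
    refine sum_congr rfl fun F hF ↦ ?_
    have hFr : #F ≤ r := (card_le_univ F).trans (by omega)
    have hQ : Q F := by
      simp only [hS, mem_filter, mem_univ, true_and] at hF
      exact hF.1
    obtain ⟨h0, -⟩ := hmem F hF
    have hfib : (univ.filter fun f : Sym α r ↦ Q (f : Multiset α).toFinset).filter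
        (fun f : Sym α r ↦ (f : Multiset α).toFinset = F) = univ.filter fun f : Sym α r ↦
          (f : Multiset α).toFinset = F := by
      ext f
      simp only [mem_filter, mem_univ, true_and, and_iff_right_iff_imp]
      rintro rfl
      exact hQ
    rw [hfib, card_sym_toFinset_eq F hFr, preHilbertPoly_eq_choose_sub_add ℚ _ hFr,
      Nat.multichoose_eq]
    have e : #F + (r - #F) - 1 = r - #F + (#F - 1) := by omega
    rw [e, Nat.choose_symm_add]
  · apply natDegree_eq_of_le_of_coeff_ne_zero
    · refine natDegree_sum_le_of_forall_le _ _ fun F hF ↦ ?_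
      rw [natDegree_preHilbertPoly]
      have := hmem F hF
      omega
    · rw [finsetSum_coeff]
      obtain ⟨F, hQ, hF⟩ := hex
      refine (sum_pos' (fun G hG ↦ ?_) ⟨F, ?_, ?_⟩).ne'
      · have := hmem G hG
        rcases (show #G - 1 ≤ d by omega).lt_or_eq with h | h
        · rw [coeff_eq_zero_of_natDegree_lt (by rwa [natDegree_preHilbertPoly])]
        · rw [← h, coeff_preHilbertPoly_self]
          positivity
      · simp only [hS, mem_filter, mem_univ, true_and]
        exact ⟨hQ, card_pos.1 (by omega)⟩
      · rw [hF, Nat.add_sub_cancel, coeff_preHilbertPoly_self]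
        positivity

open Finset in
theorem card_le_of_forall_not_lt_and_lt {m n : ℕ} (s : Finset (Fin m × Fin n)) (p q : ℕ)
    (hs : ∀ a ∈ s, ∀ b ∈ s, ¬ (a.1 < b.1 ∧ a.2 < b.2))
    (hpq : ∀ a ∈ s, p ≤ (a.1 : ℕ) ∧ q ≤ (a.2 : ℕ)) :
    #s ≤ m + n - 1 - q - p := by
  have hcard : #(Ico p (m + n - 1 - q)) = m + n - 1 - q - p := Nat.card_Ico _ _
  rw [← hcard]
  refine card_le_card_of_injOn (fun a ↦ (a.1 : ℕ) + (n - 1 - a.2)) ?_ ?_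
  · intro a ha
    have := hpq a ha
    simp only [coe_Ico, Set.mem_Ico]
    omega
  · intro a ha b hb hab
    have h1 := hs a ha b hb
    have h2 := hs b hb a ha
    simp only [Fin.lt_def] at h1 h2 hab
    ext <;> omega

/-- The support condition defining `P1`, on sets of positions indexed from `0`. -/
def IsFace (m n ξ : ℕ) (F : Finset (Fin m × Fin n)) : Prop :=
  (∀ a ∈ F, ∀ b ∈ F, ∀ c ∈ F, ¬ (a.1 < b.1 ∧ b.1 < c.1 ∧ a.2 < b.2 ∧ b.2 < c.2)) ∧
  ∀ a ∈ F, ∀ b ∈ F, (b.2 : ℕ) + 1 < ξ → ¬ (a.1 < b.1 ∧ a.2 < b.2)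

theorem isFace_toFinset_iff {m n ξ r : ℕ} (f : Sym (Fin m × Fin n) r) :
    IsFace m n ξ (f : Multiset (Fin m × Fin n)).toFinset ↔
      ¬ Has3Chain (idxMS m n r f) ∧ ¬ Has2Chain ((idxMS m n r f).filter (fun p => p.2 < ξ)) := by
  have hmem (x : ℕ × ℕ) : x ∈ idxMS m n r f ↔
      ∃ a ∈ (f : Multiset (Fin m × Fin n)), ((a.1 : ℕ) + 1, (a.2 : ℕ) + 1) = x :=
    Multiset.mem_map
  unfold IsFace Has3Chain Has2Chain
  simp only [Multiset.mem_toFinset, Multiset.mem_filter, hmem, Fin.lt_def]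
  refine and_congr ⟨?_, ?_⟩ ⟨?_, ?_⟩
  · rintro h ⟨_, ⟨a, ha, rfl⟩, _, ⟨b, hb, rfl⟩, _, ⟨c, hc, rfl⟩, hlt⟩
    exact h a ha b hb c hc (by simpa using hlt)
  · intro h a ha b hb c hc hlt
    exact h ⟨_, ⟨a, ha, rfl⟩, _, ⟨b, hb, rfl⟩, _, ⟨c, hc, rfl⟩, by simpa using hlt⟩
  · rintro h ⟨_, ⟨⟨a, ha, rfl⟩, -⟩, _, ⟨⟨b, hb, rfl⟩, hξ⟩, hlt⟩
    exact h a ha b hb hξ (by simpa using hlt)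
  · intro h a ha b hb hξ hlt
    refine h ⟨_, ⟨⟨a, ha, rfl⟩, ?_⟩, _, ⟨⟨b, hb, rfl⟩, hξ⟩, by simpa using hlt⟩
    simp only
    omega

open Finset in
theorem IsFace.card_le {m n ξ k : ℕ} (hm : 2 ≤ m) (hk : 2 ≤ k) (hkn : k ≤ n) (hkξ : k = 2 ∨ k = ξ)
    {F : Finset (Fin m × Fin n)} (hF : IsFace m n ξ F) : #F ≤ 2 * m + 2 * n - k - 2 := by
  classical
  obtain ⟨h3, h2⟩ := hF
  rw [← card_filter_add_card_filter_not (s := F) (fun b ↦ ∃ a ∈ F, a.1 < b.1 ∧ a.2 < b.2)]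
  have h₁ := card_le_of_forall_not_lt_and_lt
    (F.filter fun b ↦ ∃ a ∈ F, a.1 < b.1 ∧ a.2 < b.2) 1 (k - 1) (by
      intro b hb c hc hbc
      simp only [mem_filter] at hb hc
      obtain ⟨hb, a, ha, hab⟩ := hb
      exact h3 a ha b hb c hc.1 ⟨hab.1, hbc.1, hab.2, hbc.2⟩) (by
      intro b hb
      simp only [mem_filter] at hb
      obtain ⟨hb, a, ha, hab⟩ := hb
      have := mt (h2 a ha b hb) (not_not.2 hab)
      simp only [Fin.lt_def] at hab
      omega)
  have h₀ := card_le_of_forall_not_lt_and_lt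
    (F.filter fun b ↦ ¬ ∃ a ∈ F, a.1 < b.1 ∧ a.2 < b.2) 0 0 (by
      intro b hb c hc hbc
      simp only [mem_filter] at hb hc
      exact hc.2 ⟨b, hb.1, hbc⟩) (by simp)
  omega

open Finset in
theorem exists_isFace_card_ge {m n ξ k : ℕ} (hm : 2 ≤ m) (hk : 2 ≤ k) (hkn : k ≤ n) (hξk : ξ ≤ k) :
    ∃ F : Finset (Fin m × Fin n), IsFace m n ξ F ∧ 2 * m + 2 * n - k - 2 ≤ #F := by
  classical
  set A : Finset (Fin m × Fin n) := {x | (x.1 : ℕ) = 0 ∨ (x.2 : ℕ) = 0} with hA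
  set B : Finset (Fin m × Fin n) :=
    {x | (x.1 : ℕ) = 1 ∧ k - 1 ≤ x.2 ∨ (x.2 : ℕ) = k - 1 ∧ 1 ≤ (x.1 : ℕ)} with hB
  have memA (x) : x ∈ A ↔ (x.1 : ℕ) = 0 ∨ (x.2 : ℕ) = 0 := by simp [hA]
  have memB (x) : x ∈ B ↔ (x.1 : ℕ) = 1 ∧ k - 1 ≤ x.2 ∨ (x.2 : ℕ) = k - 1 ∧ 1 ≤ (x.1 : ℕ) := by
    simp [hB]
  refine ⟨A ∪ B, ⟨?_, ?_⟩, ?_⟩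
  · intro a _ b hb c hc hlt
    simp only [mem_union, memA, memB, Fin.lt_def] at hb hc hlt
    omega
  · intro a _ b hb hξ hlt
    simp only [mem_union, memA, memB, Fin.lt_def] at hb hlt
    omega
  · have hAB : Disjoint A B := by
      rw [disjoint_left]
      intro x hxA hxB
      rw [memA] at hxA
      rw [memB] at hxB
      omega
    have cA : #(range (m + n - 1)) ≤ #A := by
      refine card_le_card_of_surjOn (fun a ↦ (a.1 : ℕ) + (n - 1 - a.2)) fun t ht ↦ ?_
      simp only [coe_range, Set.mem_Iio] at ht
      by_cases h : t < n
      · refine ⟨(⟨0, by omega⟩, ⟨n - 1 - t, by omega⟩), ?_, ?_⟩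
        · simp [memA]
        · simp only
          omega
      · refine ⟨(⟨t - n + 1, by omega⟩, ⟨0, by omega⟩), ?_, ?_⟩
        · simp [memA]
        · simp only
          omega
    have cB : #(Ico 1 (m + n - k)) ≤ #B := by
      refine card_le_card_of_surjOn (fun a ↦ (a.1 : ℕ) + (n - 1 - a.2)) fun t ht ↦ ?_
      simp only [coe_Ico, Set.mem_Ico] at ht
      by_cases h : t ≤ n - k + 1
      · refine ⟨(⟨1, by omega⟩, ⟨n - t, by omega⟩), ?_, ?_⟩
        · exact (memB _).2 (Or.inl ⟨rfl, show k - 1 ≤ n - t by omega⟩)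
        · simp only
          omega
      · refine ⟨(⟨t + k - n, by omega⟩, ⟨k - 1, by omega⟩), ?_, ?_⟩
        · exact (memB _).2 (Or.inr ⟨rfl, show 1 ≤ t + k - n by omega⟩)
        · simp only
          omega
    rw [card_union_of_disjoint hAB]
    rw [card_range] at cA
    rw [Nat.card_Ico] at cB
    omega

/-- Corollary 2.1 of the paper: `P1 m n ξ ·` is eventually a polynomial in `r`, of degree
`2m+2n-5` if `ξ = 1` and `2m+2n-ξ-3` if `ξ ≥ 2`. -/
theorem P1_degree (m n ξ : ℕ) (hm : 2 ≤ m) (hn : 2 ≤ n) (hξ1 : 1 ≤ ξ) (hξn : ξ ≤ n) :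
    ∃ p : Polynomial ℚ,
      (∀ᶠ r in Filter.atTop, (P1 m n ξ r : ℚ) = p.eval (r : ℚ)) ∧
      p.natDegree = (if ξ = 1 then 2 * m + 2 * n - 5 else 2 * m + 2 * n - ξ - 3) := by
  obtain ⟨k, hk, hkn, hξk, hkξ⟩ : ∃ k, 2 ≤ k ∧ k ≤ n ∧ ξ ≤ k ∧ (k = 2 ∧ ξ = 1 ∨ k = ξ) := by
    rcases hξ1.eq_or_lt with h | h
    · exact ⟨2, le_rfl, hn, by omega, by omega⟩
    · exact ⟨ξ, h, hξn, le_rfl, by omega⟩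
  have hd : (if ξ = 1 then 2 * m + 2 * n - 5 else 2 * m + 2 * n - ξ - 3) =
      2 * m + 2 * n - k - 3 := by
    split_ifs <;> omega
  rw [hd]
  have hle (F) (hF : IsFace m n ξ F) : F.card ≤ 2 * m + 2 * n - k - 3 + 1 := by
    have := hF.card_le hm hk hkn (by omega)
    omega
  obtain ⟨F, hF, hcard⟩ := exists_isFace_card_ge hm hk hkn hξk
  have hFle := hle F hF
  obtain ⟨p, hp, hdeg⟩ := exists_polynomial_card_sym_of_toFinset (IsFace m n ξ) hle
    ⟨F, hF, by omega⟩
  simp only [isFace_toFinset_iff] at hp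
  exact ⟨p, hp, hdeg⟩
end

section
/- (Lemma 2.3, recursion for P_2.) For all integers m, n ≥ 2, every integer ρ with 1 ≤ ρ ≤ m−1, every integer ξ with 2 ≤ ξ ≤ n, and every integer r > 1, one has P_2(m,n,ρ,ξ,r) = Σ_{ρ'=1}^{ρ} Σ_{ξ'=ξ}^{n} [ Σ_{r_1,r_2 > 0, r_1+r_2 ≤ r} C(ρ−ρ'−1+r_2, r_2−1)·C(ξ−2+r_2, r_2)·C(m−ρ−1+r_1, r_1)·C(ξ'−ξ−1+r_1, r_1−1)·P_2(ρ, n−ξ+1, ρ', ξ'−ξ+1, r−r_1−r_2) ] + P_1(ρ, n, ξ, r) + P_1(n−ξ+1, m, m−ρ+1, r) − h_3(ρ, n−ξ+1, r). -/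
/-- `P2 m n ρ ξ r`: number of degree-`r` monomials `f` such that every `(i,j)` in the
index multiset satisfies `i ≤ ρ` or `j ≥ ξ`, the index multiset contains no 3-chain, and
neither the part with `j < ξ` nor the part with `i > ρ` contains a 2-chain. -/
noncomputable def P2 (m n ρ ξ r : ℕ) : ℕ :=
  Nat.card {f : Sym (Fin m × Fin n) r //
    (∀ p ∈ idxMS m n r f, p.1 ≤ ρ ∨ ξ ≤ p.2) ∧
    ¬ Has3Chain (idxMS m n r f) ∧
    ¬ Has2Chain ((idxMS m n r f).filter (fun p => p.2 < ξ)) ∧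
    ¬ Has2Chain ((idxMS m n r f).filter (fun p => ρ < p.1)) }

/-- The multisets of cardinality `k` with all elements in `s`. -/
def multisetsOn {α : Type*} [DecidableEq α] (s : Finset α) (k : ℕ) : Finset (Multiset α) :=
  (s.sym k).map ⟨Sym.toMultiset, Sym.coe_injective⟩

theorem mem_multisetsOn {α : Type*} [DecidableEq α] {s : Finset α} {k : ℕ} {M : Multiset α} :
    M ∈ multisetsOn s k ↔ M.card = k ∧ ∀ x ∈ M, x ∈ s := by
  simp only [multisetsOn, Finset.mem_map, Finset.mem_sym_iff, Function.Embedding.coeFn_mk]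
  constructor
  · rintro ⟨f, hf, rfl⟩
    exact ⟨f.2, hf⟩
  · rintro ⟨h, hM⟩
    exact ⟨⟨M, h⟩, hM, rfl⟩

/-- Counting symmetric powers along an injection. -/
theorem natCard_sym_eq_card {α β : Type*} [DecidableEq β] {r : ℕ} (e : α → β)
    (he : Function.Injective e)
    (R : Finset β) (hR : ∀ x, x ∈ R ↔ x ∈ Set.range e) (P : Sym α r → Prop) (Q : Multiset β → Prop)
    [DecidablePred Q] (h : ∀ f : Sym α r, P f ↔ Q ((f : Multiset α).map e)) :
    Nat.card {f : Sym α r // P f} = ((multisetsOn R r).filter Q).card := by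
  rw [← Fintype.card_coe, ← Nat.card_eq_fintype_card]
  have hT : ∀ S, S ∈ (multisetsOn R r).filter Q ↔
      (S.card = r ∧ ∀ x ∈ S, x ∈ Set.range e) ∧ Q S := fun S => by
    rw [Finset.mem_filter, mem_multisetsOn]
    simp only [hR]
  refine Nat.card_congr (Equiv.ofBijective
    (fun f => ⟨(f.1 : Multiset α).map e, (hT _).2 ⟨by simp, (h _).1 f.2⟩⟩) ⟨?_, ?_⟩)
  · rintro ⟨f, hf⟩ ⟨g, hg⟩ hfg
    exact Subtype.ext (Sym.coe_injective (Multiset.map_injective he (Subtype.ext_iff.1 hfg)))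
  · rintro ⟨S, hS⟩
    obtain ⟨⟨hc, hr⟩, hQ⟩ := (hT S).1 hS
    have : CanLift β α e (· ∈ Set.range e) := ⟨fun _ hx => hx⟩
    lift S to Multiset α using hr
    exact ⟨⟨⟨S, by simpa using hc⟩, (h _).2 hQ⟩, rfl⟩

theorem card_multisetsOn {α : Type*} [DecidableEq α] (s : Finset α) (k : ℕ) :
    (multisetsOn s k).card = (s.card + k - 1).choose k := by
  have h := natCard_sym_eq_card (α := s) (r := k) Subtype.val Subtype.val_injective s (by simp)
    (fun _ => True) (fun _ => True) (by simp)
  rw [Nat.card_congr (Equiv.subtypeUnivEquiv (by simp)), Sym.natCard_sym_eq_choose,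
    Nat.card_eq_fintype_card, Fintype.card_coe, Finset.filter_true] at h
  convert h.symm

open Classical in
theorem card_filter_isLeast_multisetsOn {a b c k : ℕ} (hc : c ∈ Finset.Icc a b) (hk : 1 ≤ k) :
    ((multisetsOn (Finset.Icc a b) k).filter (fun M => IsLeast {x | x ∈ M} c)).card =
      (b + k - c - 1).choose (k - 1) := by
  have hc' := Finset.mem_Icc.1 hc
  have : b + k - c - 1 = (Finset.Icc c b).card + (k - 1) - 1 := by
    rw [Nat.card_Icc]; omega
  rw [this, ← card_multisetsOn]
  symm
  refine Finset.card_bij (fun M _ => c ::ₘ M) ?_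
    (fun _ _ _ _ h => (Multiset.cons_inj_right _).1 h) ?_
  · intro M hM
    rw [Finset.mem_filter]
    simp only [mem_multisetsOn, IsLeast, lowerBounds, Finset.mem_Icc,
      Multiset.card_cons, Multiset.mem_cons, Set.mem_ofPred_eq] at hM ⊢
    grind
  · intro M hM
    rw [Finset.mem_filter] at hM
    simp only [mem_multisetsOn, IsLeast, lowerBounds, Finset.mem_Icc, Set.mem_ofPred_eq] at hM
    obtain ⟨⟨h1, h2⟩, h3, h4⟩ := hM
    obtain ⟨N, rfl⟩ := Multiset.exists_cons_of_mem h3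
    refine ⟨N, ?_, rfl⟩
    simp only [mem_multisetsOn, Finset.mem_Icc, Multiset.card_cons, Multiset.mem_cons] at *
    grind

open Classical in
theorem card_filter_isGreatest_multisetsOn {a b c k : ℕ} (hc : c ∈ Finset.Icc a b) (hk : 1 ≤ k) :
    ((multisetsOn (Finset.Icc a b) k).filter (fun M => IsGreatest {x | x ∈ M} c)).card =
      (c + k - a - 1).choose (k - 1) := by
  have hc' := Finset.mem_Icc.1 hc
  have : c + k - a - 1 = (Finset.Icc a c).card + (k - 1) - 1 := by
    rw [Nat.card_Icc]; omega
  rw [this, ← card_multisetsOn]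
  symm
  refine Finset.card_bij (fun M _ => c ::ₘ M) ?_
    (fun _ _ _ _ h => (Multiset.cons_inj_right _).1 h) ?_
  · intro M hM
    rw [Finset.mem_filter]
    simp only [mem_multisetsOn, IsGreatest, upperBounds, Finset.mem_Icc,
      Multiset.card_cons, Multiset.mem_cons, Set.mem_ofPred_eq] at hM ⊢
    grind
  · intro M hM
    rw [Finset.mem_filter] at hM
    simp only [mem_multisetsOn, IsGreatest, upperBounds, Finset.mem_Icc, Set.mem_ofPred_eq] at hM
    obtain ⟨⟨h1, h2⟩, h3, h4⟩ := hM
    obtain ⟨N, rfl⟩ := Multiset.exists_cons_of_mem h3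
    refine ⟨N, ?_, rfl⟩
    simp only [mem_multisetsOn, Finset.mem_Icc, Multiset.card_cons, Multiset.mem_cons] at *
    grind

/-- A multiset without 2-chains can be listed with weakly increasing first and weakly
decreasing second coordinates. -/
theorem exists_list_of_not_has2Chain {S : Multiset (ℕ × ℕ)} (hS : ¬ Has2Chain S) :
    ∃ l : List (ℕ × ℕ), (l : Multiset (ℕ × ℕ)) = S ∧ l.map Prod.fst = (S.map Prod.fst).sort (· ≤ ·) ∧
      l.map Prod.snd = (S.map Prod.snd).sort (· ≥ ·) := by
  let f : ℕ × ℕ → ℕ ×ₗ ℕᵒᵈ := fun p => toLex (p.1, OrderDual.toDual p.2)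
  let g : ℕ ×ₗ ℕᵒᵈ → ℕ × ℕ := fun p => ((ofLex p).1, OrderDual.ofDual (ofLex p).2)
  have hl : ((((S.map f).sort (· ≤ ·)).map g : List (ℕ × ℕ)) : Multiset (ℕ × ℕ)) = S := by
    rw [← Multiset.map_coe, Multiset.sort_eq, Multiset.map_map]
    exact Multiset.map_id' S
  generalize hL : ((S.map f).sort (· ≤ ·)).map g = l at hl
  have hlex : l.Pairwise (fun a b => a.1 < b.1 ∨ a.1 = b.1 ∧ b.2 ≤ a.2) := by
    rw [← hL, List.pairwise_map]
    refine (Multiset.pairwise_sort _ _).imp ?_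
    intro a b hab
    exact Prod.Lex.le_iff.1 hab
  have hmem : ∀ p, p ∈ l ↔ p ∈ S := fun p => by rw [← hl]; rfl
  refine ⟨l, hl, ?_, ?_⟩
  · refine List.Perm.eq_of_pairwise' (r := (· ≤ ·)) ?_ (Multiset.pairwise_sort _ _) ?_
    · rw [List.pairwise_map]
      exact hlex.imp fun h => by omega
    · rw [← Multiset.coe_eq_coe, Multiset.sort_eq, ← hl, Multiset.map_coe]
  · refine List.Perm.eq_of_pairwise' (r := (· ≥ ·)) ?_ (Multiset.pairwise_sort _ _) ?_
    · rw [List.pairwise_map]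
      refine hlex.imp_of_mem fun {a b} ha hb h => ?_
      by_contra hlt
      exact hS ⟨a, (hmem a).1 ha, b, (hmem b).1 hb, by omega, by omega⟩
    · rw [← Multiset.coe_eq_coe, Multiset.sort_eq, ← hl, Multiset.map_coe]

theorem eq_of_not_has2Chain {S S' : Multiset (ℕ × ℕ)} (hS : ¬ Has2Chain S) (hS' : ¬ Has2Chain S')
    (h₁ : S.map Prod.fst = S'.map Prod.fst) (h₂ : S.map Prod.snd = S'.map Prod.snd) : S = S' := by
  obtain ⟨l, rfl, hl₁, hl₂⟩ := exists_list_of_not_has2Chain hS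
  obtain ⟨l', rfl, hl₁', hl₂'⟩ := exists_list_of_not_has2Chain hS'
  rw [List.zip_of_prod hl₁ hl₂, List.zip_of_prod hl₁' hl₂', h₁, h₂]

theorem exists_not_has2Chain {R Q : Multiset ℕ} (h : R.card = Q.card) :
    ∃ S : Multiset (ℕ × ℕ), ¬ Has2Chain S ∧ S.map Prod.fst = R ∧ S.map Prod.snd = Q := by
  have hlen : (R.sort (· ≤ ·)).length = (Q.sort (· ≥ ·)).length := by simpa using h
  have hfst : ((R.sort (· ≤ ·)).zip (Q.sort (· ≥ ·))).map Prod.fst = R.sort (· ≤ ·) :=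
    List.map_fst_zip hlen.le
  have hsnd : ((R.sort (· ≤ ·)).zip (Q.sort (· ≥ ·))).map Prod.snd = Q.sort (· ≥ ·) :=
    List.map_snd_zip hlen.ge
  generalize (R.sort (· ≤ ·)).zip (Q.sort (· ≥ ·)) = l at hfst hsnd
  refine ⟨l, ?_, by rw [Multiset.map_coe, hfst, Multiset.sort_eq],
    by rw [Multiset.map_coe, hsnd, Multiset.sort_eq]⟩
  have h₁ : l.Pairwise (fun a b => a.1 ≤ b.1) := by
    rw [← List.pairwise_map (f := Prod.fst) (R := (· ≤ ·)), hfst]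
    exact Multiset.pairwise_sort _ _
  have h₂ : l.Pairwise (fun a b => b.2 ≤ a.2) := by
    rw [← List.pairwise_map (f := Prod.snd) (R := (· ≥ ·)), hsnd]
    exact Multiset.pairwise_sort _ _
  have hpair : ∀ a ∈ l, ∀ b ∈ l, ¬ (a.1 < b.1 ∧ a.2 < b.2) ∧ ¬ (b.1 < a.1 ∧ b.2 < a.2) := by
    intro a ha b hb
    refine List.Pairwise.forall_of_forall_of_flip
      (R := fun a b : ℕ × ℕ => ¬ (a.1 < b.1 ∧ a.2 < b.2) ∧ ¬ (b.1 < a.1 ∧ b.2 < a.2))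
      (fun _ _ => by omega) ?_ ?_ ha hb
    · exact (h₁.and h₂).imp fun h => by omega
    · exact (h₁.and h₂).imp fun h => by simp only [flip]; omega
  rintro ⟨a, ha, b, hb, hab⟩
  exact (hpair a ha b hb).1 hab

/-- Multisets without 2-chains are determined by their two coordinate multisets, which can be
chosen independently. -/
theorem card_eq_mul_of_not_has2Chain {k : ℕ} {X Y : Finset (Multiset ℕ)}
    {T : Finset (Multiset (ℕ × ℕ))} (hX : ∀ R ∈ X, R.card = k) (hY : ∀ Q ∈ Y, Q.card = k)
    (hT : ∀ S, S ∈ T ↔ ¬ Has2Chain S ∧ S.map Prod.fst ∈ X ∧ S.map Prod.snd ∈ Y) :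
    T.card = X.card * Y.card := by
  rw [← Finset.card_product]
  refine Finset.card_bij (fun S _ => (S.map Prod.fst, S.map Prod.snd)) ?_ ?_ ?_
  · intro S hS
    exact Finset.mem_product.2 ((hT S).1 hS).2
  · intro S hS S' hS' h
    exact eq_of_not_has2Chain ((hT S).1 hS).1 ((hT S').1 hS').1 (Prod.ext_iff.1 h).1
      (Prod.ext_iff.1 h).2
  · rintro ⟨R, Q⟩ hRQ
    obtain ⟨hR, hQ⟩ := Finset.mem_product.1 hRQ
    obtain ⟨S, hS, rfl, rfl⟩ := exists_not_has2Chain ((hX R hR).trans (hY Q hQ).symm)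
    exact ⟨S, (hT S).2 ⟨hS, hR, hQ⟩, rfl⟩

open Classical in
theorem card_filter_isLeast_fst {a b c d k ρ : ℕ} (hρ : ρ ∈ Finset.Icc a b) (hk : 1 ≤ k) :
    ((multisetsOn (Finset.Icc a b ×ˢ Finset.Icc c d) k).filter
      (fun S => ¬ Has2Chain S ∧ IsLeast {x | x ∈ S.map Prod.fst} ρ)).card =
      (b + k - ρ - 1).choose (k - 1) * (d + 1 - c + k - 1).choose k := by
  rw [← card_filter_isLeast_multisetsOn hρ hk, ← Nat.card_Icc c d, ← card_multisetsOn]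
  refine card_eq_mul_of_not_has2Chain (k := k) (by grind [mem_multisetsOn])
    (by grind [mem_multisetsOn]) fun S => ?_
  simp only [Finset.mem_filter, mem_multisetsOn, Multiset.card_map, Finset.mem_product,
    Multiset.forall_mem_map_iff]
  grind

open Classical in
theorem card_filter_isGreatest_snd {a b c d k ξ : ℕ} (hξ : ξ ∈ Finset.Icc c d) (hk : 1 ≤ k) :
    ((multisetsOn (Finset.Icc a b ×ˢ Finset.Icc c d) k).filter
      (fun S => ¬ Has2Chain S ∧ IsGreatest {x | x ∈ S.map Prod.snd} ξ)).card =
      (b + 1 - a + k - 1).choose k * (ξ + k - c - 1).choose (k - 1) := by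
  rw [← card_filter_isGreatest_multisetsOn hξ hk, ← Nat.card_Icc a b, ← card_multisetsOn]
  refine card_eq_mul_of_not_has2Chain (k := k) (by grind [mem_multisetsOn])
    (by grind [mem_multisetsOn]) fun S => ?_
  simp only [Finset.mem_filter, mem_multisetsOn, Multiset.card_map, Finset.mem_product,
    Multiset.forall_mem_map_iff]
  grind

open Classical in
theorem Finset.card_eq_sum_card_filter_of_existsUnique {α ι : Type*} {T : Finset α} {I : Finset ι}
    {p : ι → α → Prop} (h : ∀ x ∈ T, ∃! i, i ∈ I ∧ p i x) :
    T.card = ∑ i ∈ I, (T.filter (p i)).card := by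
  have : ∀ x ∈ T, (I.filter (fun i => p i x)).card = 1 := by
    intro x hx
    obtain ⟨i, hi, hu⟩ := h x hx
    refine Finset.card_eq_one.2 ⟨i, Finset.ext fun j => ?_⟩
    rw [Finset.mem_filter, Finset.mem_singleton]
    exact ⟨hu j, fun hj => hj ▸ hi⟩
  rw [Finset.card_eq_sum_ones, ← Finset.sum_congr rfl this]
  exact Finset.sum_card_bipartiteAbove_eq_sum_card_bipartiteBelow (fun x i => p i x)

section Transport

variable {α : Type*} {S : Multiset α} {e e' : α → ℕ × ℕ}

theorem has2Chain_map_congr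
    (h : ∀ a b, (e a).1 < (e b).1 ∧ (e a).2 < (e b).2 ↔ (e' a).1 < (e' b).1 ∧ (e' a).2 < (e' b).2) :
    Has2Chain (S.map e) ↔ Has2Chain (S.map e') := by
  simp only [Has2Chain, Multiset.mem_map, exists_exists_and_eq_and, h]

theorem has2Chain_map_congr_flip
    (h : ∀ a b, (e a).1 < (e b).1 ∧ (e a).2 < (e b).2 ↔ (e' b).1 < (e' a).1 ∧ (e' b).2 < (e' a).2) :
    Has2Chain (S.map e) ↔ Has2Chain (S.map e') := by
  simp only [Has2Chain, Multiset.mem_map, exists_exists_and_eq_and, h]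
  constructor <;> rintro ⟨a, ha, b, hb, hab⟩ <;> exact ⟨b, hb, a, ha, hab⟩

theorem has3Chain_map_congr
    (h : ∀ a b, (e a).1 < (e b).1 ∧ (e a).2 < (e b).2 ↔ (e' a).1 < (e' b).1 ∧ (e' a).2 < (e' b).2) :
    Has3Chain (S.map e) ↔ Has3Chain (S.map e') := by
  simp only [Has3Chain, Multiset.mem_map, exists_exists_and_eq_and]
  constructor <;> rintro ⟨a, ha, b, hb, c, hc, h₁, h₂, h₃, h₄⟩ <;>
    refine ⟨a, ha, b, hb, c, hc, ?_⟩
  · have := (h a b).1 ⟨h₁, h₃⟩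
    have := (h b c).1 ⟨h₂, h₄⟩
    tauto
  · have := (h a b).2 ⟨h₁, h₃⟩
    have := (h b c).2 ⟨h₂, h₄⟩
    tauto

theorem has3Chain_map_congr_flip
    (h : ∀ a b, (e a).1 < (e b).1 ∧ (e a).2 < (e b).2 ↔ (e' b).1 < (e' a).1 ∧ (e' b).2 < (e' a).2) :
    Has3Chain (S.map e) ↔ Has3Chain (S.map e') := by
  simp only [Has3Chain, Multiset.mem_map, exists_exists_and_eq_and]
  constructor <;> rintro ⟨a, ha, b, hb, c, hc, h₁, h₂, h₃, h₄⟩ <;>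
    refine ⟨c, hc, b, hb, a, ha, ?_⟩
  · have := (h a b).1 ⟨h₁, h₃⟩
    have := (h b c).1 ⟨h₂, h₄⟩
    tauto
  · have := (h b a).2 ⟨h₁, h₃⟩
    have := (h c b).2 ⟨h₂, h₄⟩
    tauto

end Transport

/-- The cells of the `m × n` grid with 1-indexed entries and columns shifted by `d`. -/
def gridShift (m n d : ℕ) (p : Fin m × Fin n) : ℕ × ℕ := (p.1.1 + 1, p.2.1 + 1 + d)

theorem gridShift_injective (m n d : ℕ) : Function.Injective (gridShift m n d) := by
  rintro ⟨⟨a, _⟩, ⟨b, _⟩⟩ ⟨⟨a', _⟩, ⟨b', _⟩⟩ h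
  simpa [gridShift] using h

theorem mem_range_gridShift (m n d : ℕ) (x : ℕ × ℕ) :
    x ∈ Finset.Icc 1 m ×ˢ Finset.Icc (d + 1) (d + n) ↔ x ∈ Set.range (gridShift m n d) := by
  obtain ⟨i, j⟩ := x
  simp only [gridShift, Finset.mem_product, Finset.mem_Icc, Set.mem_range, Prod.mk.injEq]
  constructor
  · rintro ⟨h₁, h₂⟩
    exact ⟨(⟨i - 1, by omega⟩, ⟨j - d - 1, by omega⟩), by simp only; omega, by simp only; omega⟩
  · rintro ⟨⟨⟨a, _⟩, ⟨b, _⟩⟩, rfl, rfl⟩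
    simp only
    omega

open Classical in
/-- `P2` counted on a grid whose columns are shifted by `d`. -/
theorem P2_eq_card (m n ρ ξ r d : ℕ) :
    P2 m n ρ ξ r = ((multisetsOn (Finset.Icc 1 m ×ˢ Finset.Icc (d + 1) (d + n)) r).filter
      (fun S => (∀ p ∈ S, p.1 ≤ ρ ∨ ξ + d ≤ p.2) ∧ ¬ Has3Chain S ∧
        ¬ Has2Chain (S.filter (fun p => p.2 < ξ + d)) ∧
        ¬ Has2Chain (S.filter (fun p => ρ < p.1)))).card := by
  refine natCard_sym_eq_card (gridShift m n d) (gridShift_injective m n d) _ (mem_range_gridShift m n d)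
    _ _ fun f => ?_
  simp only [idxMS, gridShift, Multiset.filter_map, Function.comp_def, Multiset.forall_mem_map_iff,
    add_lt_add_iff_right, add_le_add_iff_right]
  refine and_congr Iff.rfl (and_congr (not_congr (has3Chain_map_congr ?_)) (and_congr
    (not_congr (has2Chain_map_congr ?_)) (not_congr (has2Chain_map_congr ?_)))) <;>
  · intro a b
    simp [gridShift]

open Classical in
theorem P1_eq_card (m n ξ r : ℕ) :
    P1 m n ξ r = ((multisetsOn (Finset.Icc 1 m ×ˢ Finset.Icc 1 n) r).filter
      (fun S => ¬ Has3Chain S ∧ ¬ Has2Chain (S.filter (fun p => p.2 < ξ)))).card := by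
  have h := mem_range_gridShift m n 0
  rw [zero_add, zero_add] at h
  exact natCard_sym_eq_card (gridShift m n 0) (gridShift_injective m n 0) _ h _ _ fun _ => Iff.rfl

open Classical in
/-- `P1` counted on the anti-transposed grid, with rows and columns reversed and exchanged. -/
theorem P1_eq_card_antitranspose {m n ρ ξ : ℕ} (hρ : ρ ≤ m) (hξ : 1 ≤ ξ) (hξn : ξ ≤ n) (r : ℕ) :
    P1 (n - ξ + 1) m (m - ρ + 1) r =
      ((multisetsOn (Finset.Icc 1 m ×ˢ Finset.Icc ξ n) r).filter
        (fun S => ¬ Has3Chain S ∧ ¬ Has2Chain (S.filter (fun p => ρ < p.1)))).card := by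
  refine natCard_sym_eq_card (fun p : Fin (n - ξ + 1) × Fin m => (m - p.2.1, n - p.1.1)) ?_ _ ?_ _ _ ?_
  · rintro ⟨⟨a, _⟩, ⟨b, _⟩⟩ ⟨⟨a', _⟩, ⟨b', _⟩⟩ h
    simp only [Prod.mk.injEq, Fin.mk.injEq] at h ⊢
    omega
  · rintro ⟨i, j⟩
    simp only [Finset.mem_product, Finset.mem_Icc, Set.mem_range, Prod.mk.injEq]
    constructor
    · rintro ⟨h₁, h₂⟩
      exact ⟨(⟨n - j, by omega⟩, ⟨m - i, by omega⟩), by simp only; omega, by simp only; omega⟩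
    · rintro ⟨⟨⟨a, _⟩, ⟨b, _⟩⟩, rfl, rfl⟩
      simp only
      omega
  · intro f
    have hlt : ∀ p : Fin (n - ξ + 1) × Fin m, p.2.1 + 1 < m - ρ + 1 ↔ ρ < m - p.2.1 := by
      intro p
      omega
    simp only [idxMS, Multiset.filter_map, Function.comp_def, hlt]
    refine and_congr (not_congr (has3Chain_map_congr_flip ?_))
      (not_congr (has2Chain_map_congr_flip ?_)) <;>
    · rintro ⟨⟨a, _⟩, ⟨b, _⟩⟩ ⟨⟨a', _⟩, ⟨b', _⟩⟩
      simp only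
      omega

open Classical in
/-- `h3` counted on a grid whose columns are shifted by `d`. -/
theorem h3_eq_card (m n r d : ℕ) :
    h3 m n r = ((multisetsOn (Finset.Icc 1 m ×ˢ Finset.Icc (d + 1) (d + n)) r).filter
      (fun S => ¬ Has3Chain S)).card := by
  refine natCard_sym_eq_card (gridShift m n d) (gridShift_injective m n d) _ (mem_range_gridShift m n d)
    _ _ fun f => not_congr (has3Chain_map_congr fun a b => ?_)
  simp [gridShift]

/-- If the left part and the lower part of `S` contain no 2-chain, then avoiding 3-chains is a
condition on the upper right corner of `S` that depends on the other two parts only through the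
top row of the left part and the last column of the lower part. -/
theorem not_has3Chain_iff {ρ ξ ρ' ξ' : ℕ} {S : Multiset (ℕ × ℕ)}
    (hA : ¬ Has2Chain (S.filter (fun p => p.2 < ξ)))
    (hC : ¬ Has2Chain (S.filter (fun p => ρ < p.1)))
    (hρ' : IsLeast {x | x ∈ (S.filter (fun p => p.2 < ξ)).map Prod.fst} ρ')
    (hξ' : IsGreatest {x | x ∈ (S.filter (fun p => ρ < p.1)).map Prod.snd} ξ') :
    ¬ Has3Chain S ↔
      (∀ p ∈ S.filter (fun p => p.1 ≤ ρ ∧ ξ ≤ p.2), p.1 ≤ ρ' ∨ ξ' ≤ p.2) ∧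
      ¬ Has3Chain (S.filter (fun p => p.1 ≤ ρ ∧ ξ ≤ p.2)) ∧
      ¬ Has2Chain ((S.filter (fun p => p.1 ≤ ρ ∧ ξ ≤ p.2)).filter (fun p => p.2 < ξ')) ∧
      ¬ Has2Chain ((S.filter (fun p => p.1 ≤ ρ ∧ ξ ≤ p.2)).filter (fun p => ρ' < p.1)) := by
  obtain ⟨hρ'mem, hρ'le⟩ := hρ'
  obtain ⟨hξ'mem, hξ'le⟩ := hξ'
  have hle : ∀ p ∈ S, p.2 < ξ → ρ' ≤ p.1 := fun p hp h =>
    hρ'le (Multiset.mem_map_of_mem _ (Multiset.mem_filter.2 ⟨hp, h⟩))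
  have hge : ∀ p ∈ S, ρ < p.1 → p.2 ≤ ξ' := fun p hp h =>
    hξ'le (Multiset.mem_map_of_mem _ (Multiset.mem_filter.2 ⟨hp, h⟩))
  obtain ⟨a, ha, rfl⟩ := Multiset.mem_map.1 hρ'mem
  obtain ⟨c, hc, rfl⟩ := Multiset.mem_map.1 hξ'mem
  simp only [Has2Chain, Has3Chain, Multiset.mem_filter, not_exists, not_and] at *
  constructor
  · intro h
    refine ⟨fun p hp => ?_, fun x hx y hy z hz => h x hx.1 y hy.1 z hz.1, fun x hx y hy h₁ h₂ => ?_,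
      fun x hx y hy h₁ h₂ => ?_⟩
    · by_contra! hlt
      exact h a ha.1 p hp.1 c hc.1 hlt.1 (by omega) (by omega) hlt.2
    · exact h x hx.1.1 y hy.1.1 c hc.1 h₁ (by omega) h₂ hy.2
    · exact h a ha.1 x hx.1.1 y hy.1.1 hx.2 h₁ (by omega) h₂
  · rintro ⟨h₁, h₂, h₃, h₄⟩ x hx y hy z hz hxy hyz hxy' hyz'
    have hyA : ξ ≤ y.2 := by
      by_contra! hlt
      exact hA x ⟨hx, by omega⟩ y ⟨hy, hlt⟩ hxy hxy'
    have hyC : y.1 ≤ ρ := by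
      by_contra! hlt
      exact hC y ⟨hy, hlt⟩ z ⟨hz, by omega⟩ hyz hyz'
    rcases lt_or_ge x.2 ξ with hxA | hxA <;> rcases lt_or_ge ρ z.1 with hzC | hzC
    · have := h₁ y ⟨hy, hyC, hyA⟩
      have := hle x hx hxA
      have := hge z hz hzC
      omega
    · have := hle x hx hxA
      exact h₄ y ⟨⟨hy, hyC, hyA⟩, by omega⟩ z ⟨⟨hz, hzC, by omega⟩, by omega⟩ hyz hyz'
    · have := hge z hz hzC
      exact h₃ x ⟨⟨hx, by omega, hxA⟩, by omega⟩ y ⟨⟨hy, hyC, hyA⟩, by omega⟩ hxy hxy'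
    · exact h₂ x ⟨hx, by omega, hxA⟩ y ⟨hy, hyC, hyA⟩ z ⟨hz, hzC, by omega⟩ hxy hyz hxy' hyz'

/-- A multiset in the L-shaped region is the sum of its left, lower and corner parts. -/
theorem filter_add_filter_add_filter_of_mem {ρ ξ : ℕ} {S : Multiset (ℕ × ℕ)}
    (hL : ∀ p ∈ S, p.1 ≤ ρ ∨ ξ ≤ p.2) :
    S.filter (fun p => p.2 < ξ) + S.filter (fun p => ρ < p.1) +
      S.filter (fun p => p.1 ≤ ρ ∧ ξ ≤ p.2) = S := by
  have h : S.filter (fun p => p.2 < ξ ∧ ρ < p.1) = 0 :=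
    Multiset.filter_eq_nil.2 fun p hp h => by have := hL p hp; omega
  rw [Multiset.filter_add_filter, h, add_zero]
  convert Multiset.filter_add_not (fun p : ℕ × ℕ => p.2 < ξ ∨ ρ < p.1) S using 2
  refine Multiset.filter_congr fun p _ => ?_
  omega

theorem filter_add_add_of_mem {ρ ξ : ℕ} {A C B : Multiset (ℕ × ℕ)}
    (hA : ∀ p ∈ A, p.1 ≤ ρ ∧ p.2 < ξ) (hC : ∀ p ∈ C, ρ < p.1 ∧ ξ ≤ p.2)
    (hB : ∀ p ∈ B, p.1 ≤ ρ ∧ ξ ≤ p.2) :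
    (A + C + B).filter (fun p => p.2 < ξ) = A ∧ (A + C + B).filter (fun p => ρ < p.1) = C ∧
      (A + C + B).filter (fun p => p.1 ≤ ρ ∧ ξ ≤ p.2) = B := by
  simp only [Multiset.filter_add]
  refine ⟨?_, ?_, ?_⟩
  · rw [Multiset.filter_eq_self.2 fun p hp => (hA p hp).2,
      Multiset.filter_eq_nil.2 fun p hp => by have := hC p hp; omega,
      Multiset.filter_eq_nil.2 fun p hp => by have := hB p hp; omega, add_zero, add_zero]
  · rw [Multiset.filter_eq_nil.2 fun p hp => by have := hA p hp; omega,
      Multiset.filter_eq_self.2 fun p hp => (hC p hp).1,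
      Multiset.filter_eq_nil.2 fun p hp => by have := hB p hp; omega, add_zero, zero_add]
  · rw [Multiset.filter_eq_nil.2 fun p hp => by have := hA p hp; omega,
      Multiset.filter_eq_nil.2 fun p hp => by have := hC p hp; omega,
      Multiset.filter_eq_self.2 fun p hp => hB p hp, zero_add, zero_add]

/-- The conditions counted by `P2`. -/
def IsP2Multiset (ρ ξ : ℕ) (S : Multiset (ℕ × ℕ)) : Prop :=
  (∀ p ∈ S, p.1 ≤ ρ ∨ ξ ≤ p.2) ∧ ¬ Has3Chain S ∧ ¬ Has2Chain (S.filter (fun p => p.2 < ξ)) ∧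
    ¬ Has2Chain (S.filter (fun p => ρ < p.1))

/-- The left part of `S` has top row `ρ'` and `r₂` elements, and the lower part of `S` has last
column `ξ'` and `r₁` elements. -/
def HasProfile (ρ ξ ρ' ξ' r₁ r₂ : ℕ) (S : Multiset (ℕ × ℕ)) : Prop :=
  (IsLeast {x | x ∈ (S.filter (fun p => p.2 < ξ)).map Prod.fst} ρ' ∧
    (S.filter (fun p => p.2 < ξ)).card = r₂) ∧
  (IsGreatest {x | x ∈ (S.filter (fun p => ρ < p.1)).map Prod.snd} ξ' ∧
    (S.filter (fun p => ρ < p.1)).card = r₁)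

open Classical in
theorem card_filter_hasProfile {m n ρ ξ ρ' ξ' r r₁ r₂ : ℕ} (hρm : ρ < m) (hξ : 2 ≤ ξ) (hξn : ξ ≤ n)
    (hρ' : ρ' ∈ Finset.Icc 1 ρ) (hξ' : ξ' ∈ Finset.Icc ξ n) (h₁ : 1 ≤ r₁) (h₂ : 1 ≤ r₂)
    (hr : r₁ + r₂ ≤ r) :
    ((multisetsOn (Finset.Icc 1 m ×ˢ Finset.Icc 1 n) r).filter
      (fun S => IsP2Multiset ρ ξ S ∧ HasProfile ρ ξ ρ' ξ' r₁ r₂ S)).card =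
    (ρ + r₂ - ρ' - 1).choose (r₂ - 1) * (ξ - 2 + r₂).choose r₂ * (m - ρ - 1 + r₁).choose r₁ *
      (ξ' + r₁ - ξ - 1).choose (r₁ - 1) * P2 ρ (n - ξ + 1) ρ' (ξ' - ξ + 1) (r - r₁ - r₂) := by
  have hξ'' := Finset.mem_Icc.1 hξ'
  have e₁ : ξ - 1 + 1 - 1 + r₂ - 1 = ξ - 2 + r₂ := by omega
  have e₂ : m + 1 - (ρ + 1) + r₁ - 1 = m - ρ - 1 + r₁ := by omega
  have e₃ : ξ - 1 + 1 = ξ := by omega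
  have e₄ : ξ - 1 + (n - ξ + 1) = n := by omega
  have e₅ : ξ' - ξ + 1 + (ξ - 1) = ξ' := by omega
  have hA := card_filter_isLeast_fst (c := 1) (d := ξ - 1) hρ' h₂
  have hC := card_filter_isGreatest_snd (a := ρ + 1) (b := m) hξ' h₁
  have hB := P2_eq_card ρ (n - ξ + 1) ρ' (ξ' - ξ + 1) (r - r₁ - r₂) (ξ - 1)
  rw [e₁] at hA
  rw [e₂] at hC
  rw [e₃, e₄, e₅] at hB
  rw [← hA, mul_assoc _ (Nat.choose _ _) (Nat.choose _ _), ← hC, hB, ← Finset.card_product,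
    ← Finset.card_product]
  refine Finset.card_nbij' (fun S => ((S.filter (fun p => p.2 < ξ), S.filter (fun p => ρ < p.1)),
    S.filter (fun p => p.1 ≤ ρ ∧ ξ ≤ p.2))) (fun x => x.1.1 + x.1.2 + x.2) ?_ ?_ ?_ ?_
  · intro S hS
    obtain ⟨hS, ⟨hL, h3, h2A, h2C⟩, ⟨hl, hcl⟩, ⟨hg, hcg⟩⟩ := Finset.mem_filter.1 (Finset.mem_coe.1 hS)
    obtain ⟨hcard, hbox⟩ := mem_multisetsOn.1 hS
    have hsum := congrArg Multiset.card (filter_add_filter_add_filter_of_mem hL)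
    rw [Multiset.card_add, Multiset.card_add, hcl, hcg, hcard] at hsum
    simp only [Finset.mem_product, Finset.mem_Icc] at hbox
    simp only [Finset.mem_coe, Finset.mem_product, Finset.mem_filter, mem_multisetsOn, Finset.mem_Icc]
    refine ⟨⟨⟨⟨hcl, fun p hp => ?_⟩, h2A, hl⟩, ⟨⟨hcg, fun p hp => ?_⟩, h2C, hg⟩⟩,
      ⟨⟨by omega, fun p hp => ?_⟩, (not_has3Chain_iff h2A h2C hl hg).1 h3⟩⟩ <;>
    · obtain ⟨hp, hp'⟩ := Multiset.mem_filter.1 hp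
      have := hbox p hp
      have := hL p hp
      omega
  · rintro ⟨⟨A, C⟩, B⟩ hx
    simp only [Finset.mem_coe, Finset.mem_product, Finset.mem_filter, mem_multisetsOn,
      Finset.mem_Icc] at hx
    obtain ⟨⟨⟨⟨hcl, hbA⟩, h2A, hl⟩, ⟨⟨hcg, hbC⟩, h2C, hg⟩⟩, ⟨hcB, hbB⟩, hB⟩ := hx
    obtain ⟨fA, fC, fB⟩ := filter_add_add_of_mem (ρ := ρ) (ξ := ξ) (A := A) (C := C) (B := B)
      (fun p hp => by have := hbA p hp; omega) (fun p hp => by have := hbC p hp; omega)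
      (fun p hp => by have := hbB p hp; omega)
    rw [Finset.mem_coe, Finset.mem_filter, mem_multisetsOn]
    refine ⟨⟨by simp only [Multiset.card_add]; omega, fun p hp => ?_⟩, ⟨fun p hp => ?_, ?_, ?_, ?_⟩,
      ⟨?_, ?_⟩, ⟨?_, ?_⟩⟩
    · rw [Finset.mem_product, Finset.mem_Icc, Finset.mem_Icc]
      simp only [Multiset.mem_add] at hp
      rcases hp with (hp | hp) | hp
      · have := hbA p hp; omega
      · have := hbC p hp; omega
      · have := hbB p hp; omega
    · simp only [Multiset.mem_add] at hp
      rcases hp with (hp | hp) | hp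
      · have := hbA p hp; omega
      · have := hbC p hp; omega
      · have := hbB p hp; omega
    · refine (not_has3Chain_iff (ρ := ρ) (ξ := ξ) (ρ' := ρ') (ξ' := ξ') ?_ ?_ ?_ ?_).2 ?_ <;>
        simp only [fA, fC, fB] <;> assumption
    all_goals simp only [fA, fC]; assumption
  · intro S hS
    exact filter_add_filter_add_filter_of_mem (Finset.mem_filter.1 (Finset.mem_coe.1 hS)).2.1.1
  · rintro ⟨⟨A, C⟩, B⟩ hx
    simp only [Finset.mem_coe, Finset.mem_product, Finset.mem_filter, mem_multisetsOn,
      Finset.mem_Icc] at hx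
    obtain ⟨⟨⟨⟨_, hbA⟩, _⟩, ⟨⟨_, hbC⟩, _⟩⟩, ⟨_, hbB⟩, _⟩ := hx
    obtain ⟨fA, fC, fB⟩ := filter_add_add_of_mem (ρ := ρ) (ξ := ξ) (A := A) (C := C) (B := B)
      (fun p hp => by have := hbA p hp; omega) (fun p hp => by have := hbC p hp; omega)
      (fun p hp => by have := hbB p hp; omega)
    simp only [fA, fC, fB]

theorem existsUnique_hasProfile {m n ρ ξ r : ℕ} {S : Multiset (ℕ × ℕ)}
    (hS : S ∈ multisetsOn (Finset.Icc 1 m ×ˢ Finset.Icc 1 n) r) (hP : IsP2Multiset ρ ξ S)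
    (hA : ¬ ∀ p ∈ S, ξ ≤ p.2) (hC : ¬ ∀ p ∈ S, p.1 ≤ ρ) :
    ∃! i, i ∈ Finset.Icc 1 ρ ×ˢ Finset.Icc ξ n ×ˢ
        (Finset.Icc 1 r).sigma (fun r₁ => Finset.Icc 1 (r - r₁)) ∧
      HasProfile ρ ξ i.1 i.2.1 i.2.2.1 i.2.2.2 S := by
  obtain ⟨hcard, hbox⟩ := mem_multisetsOn.1 hS
  simp only [Finset.mem_product, Finset.mem_Icc] at hbox
  have hL := hP.1
  have hsum := congrArg Multiset.card (filter_add_filter_add_filter_of_mem hL)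
  rw [Multiset.card_add, Multiset.card_add, hcard] at hsum
  push Not at hA hC
  obtain ⟨a, ha, ha'⟩ := hA
  obtain ⟨c, hc, hc'⟩ := hC
  have ha'' := Multiset.mem_filter (p := fun p : ℕ × ℕ => p.2 < ξ).2 ⟨ha, ha'⟩
  have hc'' := Multiset.mem_filter (p := fun p : ℕ × ℕ => ρ < p.1).2 ⟨hc, hc'⟩
  have hcA := Multiset.card_pos_iff_exists_mem.2 ⟨a, ha''⟩
  have hcC := Multiset.card_pos_iff_exists_mem.2 ⟨c, hc''⟩
  obtain ⟨p, hp, hpmin⟩ := Finset.exists_min_image (S.filter (fun p => p.2 < ξ)).toFinset Prod.fst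
    ⟨a, Multiset.mem_toFinset.2 ha''⟩
  obtain ⟨q, hq, hqmax⟩ := Finset.exists_max_image (S.filter (fun p => ρ < p.1)).toFinset Prod.snd
    ⟨c, Multiset.mem_toFinset.2 hc''⟩
  simp only [Multiset.mem_toFinset] at hp hpmin hq hqmax
  have hl : IsLeast {x | x ∈ (S.filter (fun p => p.2 < ξ)).map Prod.fst} p.1 := by
    refine ⟨Multiset.mem_map_of_mem _ hp, fun x hx => ?_⟩
    obtain ⟨y, hy, rfl⟩ := Multiset.mem_map.1 hx
    exact hpmin y hy
  have hg : IsGreatest {x | x ∈ (S.filter (fun p => ρ < p.1)).map Prod.snd} q.2 := by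
    refine ⟨Multiset.mem_map_of_mem _ hq, fun x hx => ?_⟩
    obtain ⟨y, hy, rfl⟩ := Multiset.mem_map.1 hx
    exact hqmax y hy
  rw [Multiset.mem_filter] at hp hq
  refine ⟨(p.1, q.2, ⟨(S.filter (fun p => ρ < p.1)).card, (S.filter (fun p => p.2 < ξ)).card⟩),
    ⟨?_, ⟨hl, rfl⟩, hg, rfl⟩, ?_⟩
  · simp only [Finset.mem_product, Finset.mem_sigma, Finset.mem_Icc]
    have := hL p hp.1
    have := hL q hq.1
    have := hbox p hp.1
    have := hbox q hq.1
    omega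
  · rintro ⟨ρ', ξ', ⟨r₁, r₂⟩⟩ ⟨-, ⟨hl', hcl⟩, hg', hcg⟩
    obtain rfl := hl.unique hl'
    obtain rfl := hg.unique hg'
    simp only at hcl hcg
    rw [hcl, hcg]

/-- Lemma 2.3 of the paper: the recursion formula for `P2`. -/
theorem P2_recursion (m n ρ ξ r : ℕ) (hm : 2 ≤ m) (hn : 2 ≤ n)
    (hρ1 : 1 ≤ ρ) (hρm : ρ ≤ m - 1) (hξ : 2 ≤ ξ) (hξn : ξ ≤ n) (hr : 1 < r) :
    (P2 m n ρ ξ r : ℤ) =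
      (∑ ρ' ∈ Finset.Icc 1 ρ, ∑ ξ' ∈ Finset.Icc ξ n,
        ∑ r₁ ∈ Finset.Icc 1 r, ∑ r₂ ∈ Finset.Icc 1 (r - r₁),
          (Nat.choose (ρ + r₂ - ρ' - 1) (r₂ - 1) : ℤ) *
            (Nat.choose (ξ - 2 + r₂) r₂ : ℤ) *
            (Nat.choose (m - ρ - 1 + r₁) r₁ : ℤ) *
            (Nat.choose (ξ' + r₁ - ξ - 1) (r₁ - 1) : ℤ) *
            (P2 ρ (n - ξ + 1) ρ' (ξ' - ξ + 1) (r - r₁ - r₂) : ℤ))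
      + (P1 ρ n ξ r : ℤ) + (P1 (n - ξ + 1) m (m - ρ + 1) r : ℤ)
      - (h3 ρ (n - ξ + 1) r : ℤ) := by
  classical
  have hρm' : ρ < m := by omega
  set T := (multisetsOn (Finset.Icc 1 m ×ˢ Finset.Icc 1 n) r).filter (IsP2Multiset ρ ξ) with hT
  have hP2 : P2 m n ρ ξ r = T.card := by
    have h := P2_eq_card m n ρ ξ r 0
    simp only [zero_add, add_zero] at h
    rw [h]
    congr 1
    ext S
    simp only [hT, Finset.mem_filter, IsP2Multiset]
  have hP1 : P1 ρ n ξ r = (T.filter (fun S => ∀ p ∈ S, p.1 ≤ ρ)).card := by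
    rw [P1_eq_card]
    congr 1
    ext S
    simp only [hT, Finset.mem_filter, mem_multisetsOn, IsP2Multiset, Finset.mem_product,
      Finset.mem_Icc]
    constructor
    · rintro ⟨⟨h₁, h₂⟩, h₃, h₄⟩
      have h : ∀ p ∈ S, p.1 ≤ ρ := fun p hp => (h₂ p hp).1.2
      refine ⟨⟨⟨h₁, fun p hp => ?_⟩, fun p hp => Or.inl (h p hp), h₃, h₄, ?_⟩, h⟩
      · have := h₂ p hp
        omega
      · rintro ⟨a, ha, -⟩
        have := h a (Multiset.mem_filter.1 ha).1
        have := (Multiset.mem_filter.1 ha).2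
        omega
    · rintro ⟨⟨⟨h₁, h₂⟩, -, h₃, h₄, -⟩, h⟩
      exact ⟨⟨h₁, fun p hp => ⟨⟨(h₂ p hp).1.1, h p hp⟩, (h₂ p hp).2⟩⟩, h₃, h₄⟩
  have hP1' : P1 (n - ξ + 1) m (m - ρ + 1) r = (T.filter (fun S => ∀ p ∈ S, ξ ≤ p.2)).card := by
    rw [P1_eq_card_antitranspose hρm'.le (by omega) hξn]
    congr 1
    ext S
    simp only [hT, Finset.mem_filter, mem_multisetsOn, IsP2Multiset, Finset.mem_product,
      Finset.mem_Icc]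
    constructor
    · rintro ⟨⟨h₁, h₂⟩, h₃, h₄⟩
      have h : ∀ p ∈ S, ξ ≤ p.2 := fun p hp => (h₂ p hp).2.1
      refine ⟨⟨⟨h₁, fun p hp => ?_⟩, fun p hp => Or.inr (h p hp), h₃, ?_, h₄⟩, h⟩
      · have := h₂ p hp
        omega
      · rintro ⟨a, ha, -⟩
        have := h a (Multiset.mem_filter.1 ha).1
        have := (Multiset.mem_filter.1 ha).2
        omega
    · rintro ⟨⟨⟨h₁, h₂⟩, -, h₃, -, h₄⟩, h⟩
      exact ⟨⟨h₁, fun p hp => ⟨(h₂ p hp).1, h p hp, (h₂ p hp).2.2⟩⟩, h₃, h₄⟩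
  have hh3 : h3 ρ (n - ξ + 1) r =
      ((T.filter (fun S => ∀ p ∈ S, ξ ≤ p.2)).filter (fun S => ∀ p ∈ S, p.1 ≤ ρ)).card := by
    rw [h3_eq_card ρ (n - ξ + 1) r (ξ - 1), show ξ - 1 + 1 = ξ by omega,
      show ξ - 1 + (n - ξ + 1) = n by omega]
    congr 1
    ext S
    simp only [hT, Finset.mem_filter, mem_multisetsOn, IsP2Multiset, Finset.mem_product,
      Finset.mem_Icc]
    constructor
    · rintro ⟨⟨h₁, h₂⟩, h₃⟩
      have h : ∀ p ∈ S, ξ ≤ p.2 := fun p hp => (h₂ p hp).2.1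
      have h' : ∀ p ∈ S, p.1 ≤ ρ := fun p hp => (h₂ p hp).1.2
      refine ⟨⟨⟨⟨h₁, fun p hp => ?_⟩, fun p hp => Or.inr (h p hp), h₃, ?_, ?_⟩, h⟩, h'⟩
      · have := h₂ p hp
        omega
      · rintro ⟨a, ha, -⟩
        have := h a (Multiset.mem_filter.1 ha).1
        have := (Multiset.mem_filter.1 ha).2
        omega
      · rintro ⟨a, ha, -⟩
        have := h' a (Multiset.mem_filter.1 ha).1
        have := (Multiset.mem_filter.1 ha).2
        omega
    · rintro ⟨⟨⟨⟨h₁, h₂⟩, -, h₃, -⟩, h⟩, h'⟩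
      exact ⟨⟨h₁, fun p hp => ⟨⟨(h₂ p hp).1.1, h' p hp⟩, h p hp, (h₂ p hp).2.2⟩⟩, h₃⟩
  have hD : ((T.filter (fun S => ¬ ∀ p ∈ S, ξ ≤ p.2)).filter (fun S => ¬ ∀ p ∈ S, p.1 ≤ ρ)).card =
      ∑ ρ' ∈ Finset.Icc 1 ρ, ∑ ξ' ∈ Finset.Icc ξ n, ∑ r₁ ∈ Finset.Icc 1 r,
        ∑ r₂ ∈ Finset.Icc 1 (r - r₁),
          (ρ + r₂ - ρ' - 1).choose (r₂ - 1) * (ξ - 2 + r₂).choose r₂ *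
            (m - ρ - 1 + r₁).choose r₁ * (ξ' + r₁ - ξ - 1).choose (r₁ - 1) *
            P2 ρ (n - ξ + 1) ρ' (ξ' - ξ + 1) (r - r₁ - r₂) := by
    rw [Finset.card_eq_sum_card_filter_of_existsUnique
      (I := Finset.Icc 1 ρ ×ˢ Finset.Icc ξ n ×ˢ
        (Finset.Icc 1 r).sigma (fun r₁ => Finset.Icc 1 (r - r₁)))
      (p := fun i S => HasProfile ρ ξ i.1 i.2.1 i.2.2.1 i.2.2.2 S), Finset.sum_product]
    · refine Finset.sum_congr rfl fun ρ' hρ' => ?_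
      rw [Finset.sum_product]
      refine Finset.sum_congr rfl fun ξ' hξ' => ?_
      rw [Finset.sum_sigma]
      refine Finset.sum_congr rfl fun r₁ h₁ => Finset.sum_congr rfl fun r₂ h₂ => ?_
      rw [Finset.mem_Icc] at h₁ h₂
      rw [← card_filter_hasProfile hρm' hξ hξn hρ' hξ' h₁.1 h₂.1 (by omega)]
      congr 1
      ext S
      simp only [hT, Finset.mem_filter]
      constructor
      · rintro ⟨⟨⟨⟨hS, hP⟩, -⟩, -⟩, hp⟩
        exact ⟨hS, hP, hp⟩
      · rintro ⟨hS, hP, hp⟩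
        obtain ⟨a, ha, -⟩ := Multiset.mem_map.1 hp.1.1.1
        obtain ⟨c, hc, -⟩ := Multiset.mem_map.1 hp.2.1.1
        rw [Multiset.mem_filter] at ha hc
        exact ⟨⟨⟨⟨hS, hP⟩, fun h => (h a ha.1).not_gt ha.2⟩, fun h => (h c hc.1).not_gt hc.2⟩, hp⟩
    · intro S hS
      simp only [hT, Finset.mem_filter] at hS
      exact existsUnique_hasProfile hS.1.1.1 hS.1.1.2 hS.1.2 hS.2
  have hsplit := Finset.card_filter_add_card_filter_not (s := T) (fun S => ∀ p ∈ S, ξ ≤ p.2)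
  have hsplit₂ := Finset.card_filter_add_card_filter_not
    (s := T.filter (fun S => ¬ ∀ p ∈ S, ξ ≤ p.2)) (fun S => ∀ p ∈ S, p.1 ≤ ρ)
  have hsplit₃ := Finset.card_filter_add_card_filter_not
    (s := T.filter (fun S => ∀ p ∈ S, p.1 ≤ ρ)) (fun S => ∀ p ∈ S, ξ ≤ p.2)
  have hcomm₁ : (T.filter (fun S => ∀ p ∈ S, p.1 ≤ ρ)).filter (fun S => ∀ p ∈ S, ξ ≤ p.2) =
      (T.filter (fun S => ∀ p ∈ S, ξ ≤ p.2)).filter (fun S => ∀ p ∈ S, p.1 ≤ ρ) :=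
    Finset.filter_comm _ _ _
  have hcomm₂ : (T.filter (fun S => ∀ p ∈ S, p.1 ≤ ρ)).filter (fun S => ¬ ∀ p ∈ S, ξ ≤ p.2) =
      (T.filter (fun S => ¬ ∀ p ∈ S, ξ ≤ p.2)).filter (fun S => ∀ p ∈ S, p.1 ≤ ρ) :=
    Finset.filter_comm _ _ _
  rw [hcomm₁, hcomm₂] at hsplit₃
  rw [hP2, hP1, hP1', hh3]
  have hD' := congrArg (Nat.cast : ℕ → ℤ) hD
  push_cast at hD'
  rw [← hD']
  omega
end

section
/- (Proposition 2.1, special case: closed form of the generating function of P_1.) Let m, n ≥ 2 be integers and 1 ≤ ξ ≤ n. Then in ℚ⟦t⟧ one has (1−t)^{2m+2n−ξ−2} · Σ_{r≥0} P_1(m,n,ξ,r) t^r = (Σ_{r≥0} C(m−2,r)C(n−ξ,r) t^r)·(Σ_{r≥0} C(m−1,r)C(n−1,r) t^r) − (Σ_{r≥1} C(m−1,r)C(n−2,r−1) t^r)·(Σ_{r≥0} C(m−2,r)C(n−ξ+1,r+1) t^r). -/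
section Transfer

variable {R : Type*} [CommRing R]

/-- Iterated transfer operator: `colStep x z k i` is the weight of all ways in which a walker at
height `i` can pass `k` columns, when `z` gives the weight of the final height. -/
def colStep (x : R) (z : ℕ → R) : ℕ → ℕ → R
  | 0, i => z i
  | _ + 1, 0 => z 0
  | k + 1, i + 1 => x * (colStep x z k (i + 1) + colStep x z (k + 1) i - colStep x z k i)

theorem colStep_zero_right (x : R) (z : ℕ → R) (k : ℕ) : colStep x z k 0 = z 0 := by
  cases k <;> simp [colStep]

theorem colStep_succ_sub {t x : R} (hx : x * (1 - t) = 1) (z : ℕ → R) (k i : ℕ) :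
    colStep x z (k + 1) (i + 1) - colStep x z k (i + 1) =
      colStep x z (k + 1) i - colStep x z k i + t * x *
        (colStep x z k (i + 1) + (colStep x z (k + 1) i - colStep x z k i)) := by
  rw [colStep]
  linear_combination (colStep x z k (i + 1) + (colStep x z (k + 1) i - colStep x z k i)) * hx

theorem mul_colStep_cast {t x : R} (hx : x * (1 - t) = 1) (k i : ℕ) :
    t * colStep x (fun j => (j : R)) (k + 1) i =
      colStep x (fun _ => 1) (k + 1) i - colStep x (fun _ => 1) k i := by
  induction k generalizing i with
  | zero =>
    induction i with
    | zero => simp [colStep]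
    | succ i ih =>
      simp only [colStep, Nat.cast_add, Nat.cast_one] at ih ⊢
      linear_combination x * ih - hx
  | succ k ihk =>
    induction i with
    | zero => simp [colStep]
    | succ i ih =>
      have h1 := ihk (i + 1)
      have h2 := ihk i
      rw [colStep, colStep.eq_3 x (fun _ => 1) (k + 1), colStep.eq_3 x (fun _ => 1) k i]
      rw [colStep.eq_3 x (fun _ => 1) k i] at h1
      linear_combination x * ih + x * h1 - x * h2

theorem colStep_one_row_one (x : R) (k : ℕ) :
    colStep x (fun j => if j = 1 then 1 else 0) k 1 = colStep x (fun _ => 1) k 1 := by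
  induction k with
  | zero => simp [colStep]
  | succ k ih => simp [colStep, colStep_zero_right, ih]

theorem colStep_indicator (x : R) (k i : ℕ) :
    colStep x (fun j => if j = 1 then 1 else 0) k (i + 2) =
      colStep x (fun _ => 1) k (i + 2) - colStep x (fun _ => 1) k (i + 1) := by
  induction k generalizing i with
  | zero => simp [colStep]
  | succ k ihk =>
    induction i with
    | zero =>
      have h := ihk 0
      have h1 := colStep_one_row_one x k
      have h2 := colStep_one_row_one x (k + 1)
      have h3 : colStep x (fun _ => 1) (k + 1) 1 = x * colStep x (fun _ => 1) k 1 := by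
        simp [colStep, colStep_zero_right]
      simp only [zero_add] at h ⊢
      rw [colStep, colStep.eq_3 x (fun _ => 1) k 1]
      linear_combination x * h + x * h2 - x * h1 + h3
    | succ i ih =>
      have h1 := ihk (i + 1)
      have h2 := ihk i
      rw [colStep, colStep.eq_3 x (fun _ => 1) k (i + 1 + 1),
        colStep.eq_3 x (fun _ => 1) k (i + 1)]
      rw [colStep.eq_3 x (fun _ => 1) k (i + 1)] at ih
      linear_combination x * ih + x * h1 - x * h2

theorem colStep_indicator_sub {t x : R} (hx : x * (1 - t) = 1) (k i : ℕ) :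
    colStep x (fun j => if j = 1 then 1 else 0) (k + 1) (i + 1) -
      colStep x (fun j => if j = 1 then 1 else 0) k (i + 1) =
      t * colStep x (fun _ => 1) (k + 1) (i + 1) := by
  cases i with
  | zero =>
    have h1 := colStep_one_row_one x k
    have h2 := colStep_one_row_one x (k + 1)
    have h3 : colStep x (fun _ => 1) (k + 1) 1 = x * colStep x (fun _ => 1) k 1 := by
      simp [colStep, colStep_zero_right]
    simp only [zero_add]
    linear_combination h2 - h1 + (1 - t) * h3 + colStep x (fun _ => 1) k 1 * hx
  | succ i =>
    rw [colStep_indicator, colStep_indicator, colStep.eq_3 x (fun _ => 1) k (i + 1)]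
    linear_combination
      (colStep x (fun _ => 1) k (i + 1 + 1) + colStep x (fun _ => 1) (k + 1) (i + 1)
        - colStep x (fun _ => 1) k (i + 1)) * hx

theorem colStep_balance {t x : R} (hx : x * (1 - t) = 1) (k i : ℕ) :
    colStep x (fun _ => 1) (k + 1) (i + 1) *
      (colStep x (fun _ => 1) (k + 1) (i + 1) - colStep x (fun _ => 1) k (i + 1)) =
    colStep x (fun j => (j : R)) (k + 1) (i + 1) *
      (colStep x (fun j => if j = 1 then 1 else 0) (k + 1) (i + 1) -
        colStep x (fun j => if j = 1 then 1 else 0) k (i + 1)) := by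
  rw [colStep_indicator_sub hx, ← mul_colStep_cast hx]
  ring

end Transfer

section Admissible

/-- `Admissible K p q T`: the set `T` of cells (row, column counted from the right) can follow
earlier cells for which `p` is the lowest row seen and `q` the lowest row ending a 2-chain, without
creating a 3-chain, nor a 2-chain in columns of index at least `K`. -/
def Admissible (K p q : ℕ) (T : Finset (ℕ × ℕ)) : Prop :=
  (∀ a ∈ T, a.1 ≤ q) ∧ (∀ a ∈ T, K ≤ a.2 → a.1 ≤ p) ∧
  (∀ a ∈ T, ∀ b ∈ T, a.1 < b.1 → b.2 < a.2 → a.1 ≤ p ∧ b.2 < K) ∧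
  (∀ a ∈ T, ∀ b ∈ T, ∀ c ∈ T, a.1 < b.1 → b.1 < c.1 → b.2 < a.2 → c.2 < b.2 → False)

theorem admissible_empty (K p q : ℕ) : Admissible K p q ∅ := by
  simp [Admissible]

theorem admissible_insert_of_le {K p q i c : ℕ} {T : Finset (ℕ × ℕ)} (hpq : p ≤ q) (hi : i ≤ p)
    (hT : ∀ b ∈ T, b.2 < c ∨ (b.2 = c ∧ b.1 < i)) :
    Admissible K p q (insert (i, c) T) ↔ Admissible K i q T := by
  constructor
  · rintro ⟨h1, h2, h3, h4⟩
    have hm : (i, c) ∈ insert (i, c) T := Finset.mem_insert_self _ _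
    have hs : ∀ a ∈ T, a ∈ insert (i, c) T := fun a ha => Finset.mem_insert_of_mem ha
    refine ⟨fun a ha => h1 a (hs a ha), fun a ha hK => ?_, fun a ha b hb hab hba => ⟨?_, ?_⟩,
      fun a ha b hb d hd => h4 a (hs a ha) b (hs b hb) d (hs d hd)⟩
    · by_contra hcon
      have := h3 _ hm a (hs a ha) (by simp only; omega)
      have := hT a ha
      simp only at *
      omega
    · by_contra hcon
      have := hT a ha
      exact h4 _ hm a (hs a ha) b (hs b hb) (by simp only; omega) hab (by simp only; omega) hba
    · exact (h3 a (hs a ha) b (hs b hb) hab hba).2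
  · rintro ⟨h1, h2, h3, h4⟩
    refine ⟨?_, ?_, ?_, ?_⟩
    · rintro a ha
      rcases Finset.mem_insert.1 ha with rfl | ha
      · exact hi.trans hpq
      · exact h1 a ha
    · rintro a ha hK
      rcases Finset.mem_insert.1 ha with rfl | ha
      · exact hi
      · exact (h2 a ha hK).trans hi
    · rintro a ha b hb hab hba
      rcases Finset.mem_insert.1 hb with rfl | hb
      · rcases Finset.mem_insert.1 ha with rfl | ha
        · simp at hab
        · have := hT a ha
          simp only at hab hba
          omega
      · rcases Finset.mem_insert.1 ha with rfl | ha
        · refine ⟨hi, ?_⟩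
          by_contra hK
          have := h2 b hb (by omega)
          simp only at hab
          omega
        · exact ⟨(h3 a ha b hb hab hba).1.trans hi, (h3 a ha b hb hab hba).2⟩
    · rintro a ha b hb d hd hab hbd hba hdb
      have hnot : ∀ e ∈ insert (i, c) T, e.2 ≤ c := by
        intro e he
        rcases Finset.mem_insert.1 he with rfl | he
        · exact le_rfl
        · have := hT e he
          omega
      have hb' : b ∈ T := by
        refine Finset.mem_of_mem_insert_of_ne hb fun h => ?_
        have := hnot a ha
        rw [h] at hba
        simp only at hba
        omega
      have hd' : d ∈ T := by
        refine Finset.mem_of_mem_insert_of_ne hd fun h => ?_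
        have := hnot b hb
        rw [h] at hdb
        simp only at hdb
        omega
      rcases Finset.mem_insert.1 ha with rfl | ha
      · have := (h3 b hb' d hd' hbd hdb).1
        simp only at hab
        omega
      · exact h4 a ha b hb' d hd' hab hbd hba hdb

theorem admissible_insert_of_lt {K p q i c : ℕ} {T : Finset (ℕ × ℕ)} (hi : p < i) (hiq : i ≤ q)
    (hc : c < K) (hT : ∀ b ∈ T, b.2 < c ∨ (b.2 = c ∧ b.1 < i)) :
    Admissible K p q (insert (i, c) T) ↔ Admissible K p i T := by
  constructor
  · rintro ⟨h1, h2, h3, h4⟩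
    have hm : (i, c) ∈ insert (i, c) T := Finset.mem_insert_self _ _
    have hs : ∀ a ∈ T, a ∈ insert (i, c) T := fun a ha => Finset.mem_insert_of_mem ha
    refine ⟨fun a ha => ?_, fun a ha => h2 a (hs a ha),
      fun a ha b hb => h3 a (hs a ha) b (hs b hb),
      fun a ha b hb d hd => h4 a (hs a ha) b (hs b hb) d (hs d hd)⟩
    by_contra hcon
    have := h3 _ hm a (hs a ha) (by simp only; omega)
    have := hT a ha
    simp only at *
    omega
  · rintro ⟨h1, h2, h3, h4⟩
    have hnot : ∀ e ∈ insert (i, c) T, e.1 ≤ i ∧ e.2 ≤ c := by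
      intro e he
      rcases Finset.mem_insert.1 he with rfl | he
      · exact ⟨le_rfl, le_rfl⟩
      · have := hT e he
        exact ⟨h1 e he, by omega⟩
    have hmem : ∀ a ∈ insert (i, c) T, ∀ b ∈ insert (i, c) T, a.1 < b.1 → b.2 < a.2 →
        a ∈ T ∧ b ∈ T := by
      intro a ha b hb hab hba
      constructor
      · refine Finset.mem_of_mem_insert_of_ne ha fun h => ?_
        have := hnot b hb
        rw [h] at hab
        simp only at hab
        omega
      · refine Finset.mem_of_mem_insert_of_ne hb fun h => ?_
        have := hnot a ha
        rw [h] at hba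
        simp only at hba
        omega
    refine ⟨fun a ha => (hnot a ha).1.trans hiq, fun a ha hK => ?_, fun a ha b hb hab hba => ?_,
      fun a ha b hb d hd hab hbd hba hdb => ?_⟩
    · have := hnot a ha
      omega
    · obtain ⟨ha', hb'⟩ := hmem a ha b hb hab hba
      exact h3 a ha' b hb' hab hba
    · obtain ⟨ha', hb'⟩ := hmem a ha b hb hab hba
      obtain ⟨-, hd'⟩ := hmem b hb d hd hbd hdb
      exact h4 a ha' b hb' d hd' hab hbd hba hdb

theorem not_admissible_insert {K p q i c : ℕ} {T : Finset (ℕ × ℕ)} (hi : p < i)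
    (h : q < i ∨ K ≤ c) : ¬ Admissible K p q (insert (i, c) T) := by
  rintro ⟨h1, h2, -, -⟩
  have h1 := h1 _ (Finset.mem_insert_self _ _)
  have h2 := h2 _ (Finset.mem_insert_self _ _)
  simp only at h1 h2
  omega

variable {R : Type*} [CommRing R]

open Classical in
/-- Total weight of the admissible subsets of `U`, each cell having weight `y`. -/
noncomputable def admWeight (y : R) (K : ℕ) (U : Finset (ℕ × ℕ)) (p q : ℕ) : R :=
  ∑ T ∈ U.powerset, if Admissible K p q T then y ^ T.card else 0

theorem admWeight_empty (y : R) (K p q : ℕ) : admWeight y K ∅ p q = 1 := by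
  simp [admWeight, admissible_empty]

open Classical in
theorem admWeight_insert (y : R) {K p q i c : ℕ} {U : Finset (ℕ × ℕ)} (hpq : p ≤ q)
    (hU : ∀ b ∈ U, b.2 < c ∨ (b.2 = c ∧ b.1 < i)) :
    admWeight y K (insert (i, c) U) p q = admWeight y K U p q + y *
      (if i ≤ p then admWeight y K U i q else
        if i ≤ q ∧ c < K then admWeight y K U p i else 0) := by
  have hn : (i, c) ∉ U := fun h => by have := hU _ h; simp at this
  unfold admWeight
  rw [Finset.sum_powerset_insert hn]
  congr 1
  have key : ∀ T ∈ U.powerset,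
      (if Admissible K p q (insert (i, c) T) then y ^ (insert (i, c) T).card else 0) =
      y * (if i ≤ p then (if Admissible K i q T then y ^ T.card else 0) else
        if i ≤ q ∧ c < K then (if Admissible K p i T then y ^ T.card else 0) else 0) := by
    intro T hT
    have hTU := Finset.mem_powerset.1 hT
    have hT' : ∀ b ∈ T, b.2 < c ∨ (b.2 = c ∧ b.1 < i) := fun b hb => hU b (hTU hb)
    rw [Finset.card_insert_of_notMem (fun h => hn (hTU h)), pow_succ']
    by_cases h1 : i ≤ p
    · rw [if_pos h1, admissible_insert_of_le hpq h1 hT', mul_ite, mul_zero]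
    rw [if_neg h1]
    by_cases h2 : i ≤ q ∧ c < K
    · rw [if_pos h2, admissible_insert_of_lt (by omega) h2.1 h2.2 hT', mul_ite, mul_zero]
    · rw [if_neg h2, if_neg (not_admissible_insert (by omega) (by omega)), mul_zero]
  rw [Finset.sum_congr rfl key, ← Finset.mul_sum]
  split_ifs <;> simp

/-- The cells of the `k` rightmost columns, together with the cells in rows at most `i` of the
next column. -/
def stair (m k i : ℕ) : Finset (ℕ × ℕ) :=
  Finset.Icc 1 m ×ˢ Finset.range k ∪ Finset.Icc 1 i ×ˢ {k}

theorem mem_stair {m k i : ℕ} {a : ℕ × ℕ} :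
    a ∈ stair m k i ↔ (1 ≤ a.1 ∧ a.1 ≤ m ∧ a.2 < k) ∨ (1 ≤ a.1 ∧ a.1 ≤ i ∧ a.2 = k) := by
  simp only [stair, Finset.mem_union, Finset.mem_product, Finset.mem_Icc, Finset.mem_range,
    Finset.mem_singleton, and_assoc]

theorem stair_succ_right (m k i : ℕ) : stair m k (i + 1) = insert (i + 1, k) (stair m k i) := by
  ext ⟨a, b⟩
  simp only [mem_stair, Finset.mem_insert, Prod.mk.injEq]
  omega

theorem stair_succ_zero (m k : ℕ) : stair m (k + 1) 0 = stair m k m := by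
  ext ⟨a, b⟩
  simp only [mem_stair]
  omega

theorem stair_zero_zero (m : ℕ) : stair m 0 0 = ∅ := by
  simp [stair]

open Classical in
theorem admWeight_stair_succ (y : R) {m K p q k i : ℕ} (hpq : p ≤ q) :
    admWeight y K (stair m k (i + 1)) p q = admWeight y K (stair m k i) p q + y *
      (if i + 1 ≤ p then admWeight y K (stair m k i) (i + 1) q else
        if i + 1 ≤ q ∧ k < K then admWeight y K (stair m k i) p (i + 1) else 0) := by
  rw [stair_succ_right]
  refine admWeight_insert y hpq fun b hb => ?_
  rw [mem_stair] at hb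
  omega

/-- Two-walker weight in determinantal form, the walkers having `k` and `l` columns to pass. -/
def pairDet (x : R) (k l p q : ℕ) : R :=
  colStep x (fun _ => 1) k p * colStep x (fun _ => 1) l q -
    colStep x (fun j => (j : R)) k p * colStep x (fun j => if j = 1 then 1 else 0) l q

theorem admWeight_partial_first {t x : R} (hx : x * (1 - t) = 1) {m K k l i : ℕ}
    (h : ∀ p q, 1 ≤ p → p ≤ q → 2 ≤ q → q ≤ m →
      admWeight (t * x) K (stair m k 0) p q = pairDet x k l p q)
    {p q : ℕ} (hp : 1 ≤ p) (hpq : p ≤ q) (hq : 2 ≤ q) (hqm : q ≤ m) (hip : i ≤ p) :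
    admWeight (t * x) K (stair m k i) p q = pairDet x k l p q +
      (colStep x (fun _ => 1) (k + 1) i - colStep x (fun _ => 1) k i) *
        colStep x (fun _ => 1) l q -
      (colStep x (fun j => (j : R)) (k + 1) i - colStep x (fun j => (j : R)) k i) *
        colStep x (fun j => if j = 1 then 1 else 0) l q := by
  induction i generalizing p with
  | zero => simp [h p q hp hpq hq hqm, colStep_zero_right]
  | succ i ih =>
    rw [admWeight_stair_succ _ hpq, if_pos hip, ih hp hpq (by omega),
      ih (p := i + 1) (by omega) (by omega) (by omega), colStep_succ_sub hx, colStep_succ_sub hx]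
    unfold pairDet
    ring

theorem admWeight_partial_second {t x : R} (hx : x * (1 - t) = 1) {m K k i : ℕ} (hk : k < K)
    (h : ∀ p q, 1 ≤ p → p ≤ q → 2 ≤ q → q ≤ m →
      admWeight (t * x) K (stair m k 0) p q = pairDet x k k p q)
    {p q : ℕ} (hp : 1 ≤ p) (hpq : p ≤ q) (hq : 2 ≤ q) (hqm : q ≤ m) (hpi : p ≤ i) (hiq : i ≤ q) :
    admWeight (t * x) K (stair m k i) p q =
      colStep x (fun _ => 1) (k + 1) p * (colStep x (fun _ => 1) k q +
        (colStep x (fun _ => 1) (k + 1) i - colStep x (fun _ => 1) k i)) -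
      colStep x (fun j => (j : R)) (k + 1) p *
        (colStep x (fun j => if j = 1 then 1 else 0) k q +
          (colStep x (fun j => if j = 1 then 1 else 0) (k + 1) i -
            colStep x (fun j => if j = 1 then 1 else 0) k i)) := by
  induction i, hpi using Nat.le_induction generalizing q with
  | base =>
    rw [admWeight_partial_first hx h hp hpq hq hqm le_rfl]
    obtain ⟨p, rfl⟩ := Nat.exists_eq_add_of_le' hp
    have := colStep_balance hx k p
    unfold pairDet
    linear_combination -this
  | succ i hpi ih =>
    rw [admWeight_stair_succ _ hpq, if_neg (by omega), if_pos ⟨hiq, hk⟩,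
      ih hpq hq hqm (by omega), ih (q := i + 1) (by omega) (by omega) (by omega) (by omega),
      colStep_succ_sub hx, colStep_succ_sub hx]
    ring

theorem admWeight_stair_of_le {t x : R} (hx : x * (1 - t) = 1) {m K k : ℕ} (hk : k ≤ K)
    {p q : ℕ} (hp : 1 ≤ p) (hpq : p ≤ q) (hq : 2 ≤ q) (hqm : q ≤ m) :
    admWeight (t * x) K (stair m k 0) p q = pairDet x k k p q := by
  induction k generalizing p q with
  | zero =>
    rw [stair_zero_zero, admWeight_empty]
    simp [pairDet, colStep, show q ≠ 1 by omega]
  | succ k ih =>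
    rw [stair_succ_zero]
    have key : ∀ i, q ≤ i → admWeight (t * x) K (stair m k i) p q =
        pairDet x (k + 1) (k + 1) p q := by
      intro i hi
      induction i, hi using Nat.le_induction with
      | base =>
        rw [admWeight_partial_second hx (by omega) (fun p q h1 h2 h3 h4 => ih (by omega) h1 h2 h3 h4)
          hp hpq hq hqm hpq le_rfl]
        unfold pairDet
        ring
      | succ i hi ih' =>
        rw [admWeight_stair_succ _ hpq, if_neg (by omega), if_neg (by omega), ih']
        ring
    exact key m hqm

theorem admWeight_stair_of_ge {t x : R} (hx : x * (1 - t) = 1) {m K k : ℕ} (hk : K ≤ k)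
    {p q : ℕ} (hp : 1 ≤ p) (hpq : p ≤ q) (hq : 2 ≤ q) (hqm : q ≤ m) :
    admWeight (t * x) K (stair m k 0) p q = pairDet x k K p q := by
  induction k, hk using Nat.le_induction generalizing p q with
  | base => exact admWeight_stair_of_le hx le_rfl hp hpq hq hqm
  | succ k hk ih =>
    rw [stair_succ_zero]
    have key : ∀ i, p ≤ i → admWeight (t * x) K (stair m k i) p q =
        pairDet x (k + 1) K p q := by
      intro i hi
      induction i, hi using Nat.le_induction with
      | base =>
        rw [admWeight_partial_first hx (fun p q h1 h2 h3 h4 => ih h1 h2 h3 h4)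
          hp hpq hq hqm le_rfl]
        unfold pairDet
        ring
      | succ i hi ih' =>
        rw [admWeight_stair_succ _ hpq, if_neg (by omega), if_neg (by omega), ih']
        ring
    exact key m (by omega)

end Admissible

section Series

open PowerSeries

/-- The polynomial `∑ C(a, r) C(b, r) t ^ r`. -/
noncomputable def choosePoly (a b : ℕ) : PowerSeries ℚ :=
  PowerSeries.mk fun r => ((Nat.choose a r * Nat.choose b r : ℕ) : ℚ)

theorem choosePoly_succ_succ (a b : ℕ) :
    choosePoly (a + 1) (b + 1) = choosePoly (a + 1) b + choosePoly a (b + 1) -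
      (1 - X) * choosePoly a b := by
  ext r
  cases r with
  | zero => simp [choosePoly, sub_mul]
  | succ r =>
    simp only [choosePoly, map_sub, map_add, sub_mul, one_mul, coeff_mk, coeff_succ_X_mul,
      Nat.choose_succ_succ]
    push_cast
    ring

theorem choosePoly_zero_left (b : ℕ) : choosePoly 0 b = 1 := by
  ext r
  cases r <;> simp [choosePoly, coeff_one]

theorem choosePoly_zero_right (a : ℕ) : choosePoly a 0 = 1 := by
  ext r
  cases r <;> simp [choosePoly, coeff_one]

theorem colStep_one_row_zero {R : Type*} [CommRing R] (x : R) (i : ℕ) :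
    colStep x (fun _ => 1) 1 i = x ^ i := by
  induction i with
  | zero => simp [colStep]
  | succ i ih => rw [colStep, ih]; simp [colStep]; ring

theorem colStep_one_eq_choosePoly {x : PowerSeries ℚ} (hx : x * (1 - X) = 1) (k i : ℕ) :
    colStep x (fun _ => 1) (k + 1) (i + 1) = x ^ (i + k + 1) * choosePoly i k := by
  induction k generalizing i with
  | zero => rw [colStep_one_row_zero, choosePoly_zero_right]; simp
  | succ k ihk =>
    induction i with
    | zero =>
      rw [colStep, colStep_zero_right, colStep_zero_right, ihk, choosePoly_zero_left,
        choosePoly_zero_left]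
      ring
    | succ i ih =>
      rw [colStep, ih, ihk, ihk, choosePoly_succ_succ]
      linear_combination (x ^ (i + k + 2)) * choosePoly i k * hx

theorem choosePoly_sub_right (a b : ℕ) :
    choosePoly a (b + 1) - choosePoly a b =
      PowerSeries.mk (fun r => if r = 0 then 0 else
          ((Nat.choose a r * Nat.choose b (r - 1) : ℕ) : ℚ)) := by
  ext r
  cases r with
  | zero => simp [choosePoly]
  | succ r =>
    simp [choosePoly, Nat.choose_succ_succ]
    ring

theorem choosePoly_sub_left (a b : ℕ) :
    choosePoly (a + 1) b - (1 - X) * choosePoly a b =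
      X * PowerSeries.mk (fun r => ((Nat.choose a r * Nat.choose (b + 1) (r + 1) : ℕ) : ℚ)) := by
  ext r
  cases r with
  | zero => simp [choosePoly, sub_mul]
  | succ r =>
    simp only [choosePoly, map_sub, sub_mul, one_mul, coeff_mk, coeff_succ_X_mul,
      Nat.choose_succ_succ]
    push_cast
    ring

theorem pow_mul_pairDet {x : PowerSeries ℚ} (hx : x * (1 - X) = 1) (μ ν κ : ℕ) :
    (1 - X) ^ (2 * μ + ν + κ + 4) * pairDet x (ν + 2) (κ + 1) (μ + 2) (μ + 2) =
      choosePoly μ κ * choosePoly (μ + 1) (ν + 1) -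
        (choosePoly (μ + 1) (ν + 1) - choosePoly (μ + 1) ν) *
          PowerSeries.mk
            (fun r => ((Nat.choose μ r * Nat.choose (κ + 1) (r + 1) : ℕ) : ℚ)) := by
  have hu : (1 - X : PowerSeries ℚ) ≠ 0 := fun h => by simp [h] at hx
  refine mul_left_cancel₀ (mul_ne_zero hu (X_ne_zero (R := ℚ))) ?_
  have hpow : x ^ (2 * μ + ν + κ + 5) * (1 - X) ^ (2 * μ + ν + κ + 5) = 1 := by
    rw [← mul_pow, hx, one_pow]
  have hd := choosePoly_sub_left μ κ
  have hc := mul_colStep_cast hx (ν + 1) (μ + 2)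
  have hi := colStep_indicator x (κ + 1) μ
  have h1 := colStep_one_eq_choosePoly hx (ν + 1) (μ + 1)
  have h2 := colStep_one_eq_choosePoly hx ν (μ + 1)
  have h3 := colStep_one_eq_choosePoly hx κ (μ + 1)
  have h4 := colStep_one_eq_choosePoly hx κ μ
  have e2 : x ^ (μ + 1 + ν + 1) = (1 - X) * x ^ (μ + ν + 3) := by
    linear_combination -(x ^ (μ + ν + 2)) * hx
  have e4 : x ^ (μ + κ + 1) = (1 - X) * x ^ (μ + κ + 2) := by
    linear_combination -(x ^ (μ + κ + 1)) * hx
  rw [e2] at h2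
  rw [e4] at h4
  have hF : X * pairDet x (ν + 2) (κ + 1) (μ + 2) (μ + 2) =
      x ^ (2 * μ + ν + κ + 5) *
        (X * choosePoly (μ + 1) (ν + 1) * choosePoly (μ + 1) κ -
          (choosePoly (μ + 1) (ν + 1) - (1 - X) * choosePoly (μ + 1) ν) *
            (choosePoly (μ + 1) κ - (1 - X) * choosePoly μ κ)) := by
    rw [pairDet, mul_sub, ← mul_assoc X (colStep x (fun j => (j : PowerSeries ℚ)) _ _), hc, hi,
      h1, h2, h3, h4]
    ring
  rw [mul_sub (_ * _), mul_left_comm _ (choosePoly (μ + 1) (ν + 1) - _) _,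
    mul_assoc (1 - X) X (PowerSeries.mk _), ← hd]
  linear_combination (1 - X) ^ (2 * μ + ν + κ + 5) * hF +
    (X * choosePoly (μ + 1) (ν + 1) * choosePoly (μ + 1) κ -
          (choosePoly (μ + 1) (ν + 1) - (1 - X) * choosePoly (μ + 1) ν) *
            (choosePoly (μ + 1) κ - (1 - X) * choosePoly μ κ)) * hpow

theorem coeff_geom_pow_card {α : Type*} [DecidableEq α] (T : Finset α) (r : ℕ) :
    coeff r ((X * PowerSeries.mk (fun _ => (1 : ℚ))) ^ T.card) =
      (((Finset.finsuppAntidiag T r).filter fun l => l.support = T).card : ℚ) := by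
  have hy : ∀ j, coeff j (X * PowerSeries.mk (fun _ => (1 : ℚ))) = if j = 0 then 0 else 1 := by
    intro j
    cases j <;> simp [coeff_succ_X_mul]
  rw [← Finset.prod_const, coeff_prod, Finset.card_filter, Nat.cast_sum]
  refine Finset.sum_congr rfl fun l hl => ?_
  rw [Finset.mem_finsuppAntidiag] at hl
  simp only [hy]
  split_ifs with h
  · rw [Finset.prod_eq_one, Nat.cast_one]
    intro i hi
    rw [← h, Finsupp.mem_support_iff] at hi
    rw [if_neg hi]
  · obtain ⟨i, hi, hil⟩ : ∃ i ∈ T, i ∉ l.support := by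
      by_contra! hcon
      exact h (hl.2.antisymm hcon)
    rw [Finsupp.notMem_support_iff] at hil
    rw [Finset.prod_eq_zero hi (by rw [if_pos hil]), Nat.cast_zero]

theorem card_sym_toFinset_eq_s6 {α : Type*} [Fintype α] [DecidableEq α] (T : Finset α) (r : ℕ) :
    (Finset.univ.filter fun f : Sym α r => (f : Multiset α).toFinset = T).card =
      ((Finset.finsuppAntidiag T r).filter fun l => l.support = T).card := by
  refine Finset.card_bij' (fun f _ => Multiset.toFinsupp (f : Multiset α))
    (fun l hl => ⟨Finsupp.toMultiset l, ?_⟩) ?_ ?_ ?_ ?_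
  · simp only [Finset.mem_filter, Finset.mem_finsuppAntidiag] at hl
    rw [Finsupp.card_toMultiset, Finsupp.sum, hl.2, ← hl.1.1]
    rfl
  · intro f hf
    simp only [Finset.mem_filter, Finset.mem_univ, true_and] at hf
    simp only [Finset.mem_filter, Finset.mem_finsuppAntidiag, Multiset.toFinsupp_support, hf,
      subset_refl, and_true, Multiset.toFinsupp_apply]
    rw [← hf]
    exact (Multiset.toFinset_sum_count_eq _).trans f.2
  · intro l hl
    simp only [Finset.mem_filter] at hl
    refine Finset.mem_filter.2 ⟨Finset.mem_univ _, ?_⟩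
    exact (Finsupp.toFinset_toMultiset l).trans hl.2
  · intro f hf
    ext1
    simp
  · intro l hl
    simp

open Classical in
theorem mk_card_sym {α : Type*} [Fintype α] [DecidableEq α] (P : Finset α → Prop) :
    PowerSeries.mk (fun r => (Nat.card {f : Sym α r // P (f : Multiset α).toFinset} : ℚ)) =
      ∑ T : Finset α, if P T then (X * PowerSeries.mk (fun _ => (1 : ℚ))) ^ T.card else 0 := by
  ext r
  rw [coeff_mk, map_sum, Nat.card_eq_fintype_card, Fintype.card_subtype,
    Finset.card_eq_sum_card_fiberwise (f := fun f : Sym α r => (f : Multiset α).toFinset)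
      (t := Finset.univ) (fun _ _ => Finset.mem_coe.2 (Finset.mem_univ _)), Nat.cast_sum]
  refine Finset.sum_congr rfl fun T _ => ?_
  rw [apply_ite (coeff r), coeff_geom_pow_card, ← card_sym_toFinset_eq_s6, Finset.filter_filter,
    map_zero]
  split_ifs with h
  · congr 2
    ext f
    simp only [Finset.mem_filter, Finset.mem_univ, true_and]
    exact ⟨fun hf => hf.2, fun hf => ⟨hf ▸ h, hf⟩⟩
  · rw [Nat.cast_eq_zero, Finset.card_eq_zero, Finset.filter_eq_empty_iff]
    rintro f - ⟨h1, h2⟩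
    exact h (h2 ▸ h1)

end Series

/-- The cell of a variable: row counted from `1`, column counted from the right from `0`. -/
def cellEmb (m n : ℕ) : Fin m × Fin n ↪ ℕ × ℕ where
  toFun p := (p.1.1 + 1, n - 1 - p.2.1)
  inj' := by
    rintro ⟨a, b⟩ ⟨c, d⟩ h
    simp only [Prod.mk.injEq] at h
    ext <;> simp only <;> omega

theorem cellEmb_apply {m n : ℕ} (p : Fin m × Fin n) :
    cellEmb m n p = (p.1.1 + 1, n - 1 - p.2.1) := rfl

theorem map_cellEmb_univ (m n : ℕ) : Finset.univ.map (cellEmb m n) = stair m n 0 := by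
  ext ⟨a, b⟩
  simp only [Finset.mem_map, Finset.mem_univ, true_and, mem_stair, cellEmb_apply,
    Prod.mk.injEq, Prod.exists]
  constructor
  · rintro ⟨i, j, h⟩
    omega
  · intro h
    refine ⟨⟨a - 1, by omega⟩, ⟨n - 1 - b, by omega⟩, ?_⟩
    simp only
    omega

theorem chain_conditions_iff_admissible {m n ξ r : ℕ} (hξn : ξ ≤ n)
    (f : Sym (Fin m × Fin n) r) :
    (¬ Has3Chain (idxMS m n r f) ∧
      ¬ Has2Chain ((idxMS m n r f).filter (fun p => p.2 < ξ))) ↔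
    Admissible (n - ξ + 1) m m ((f : Multiset (Fin m × Fin n)).toFinset.map (cellEmb m n)) := by
  have h1 : ∀ p : Fin m × Fin n, p.1.1 + 1 ≤ m := fun p => p.1.2
  have h2 : ∀ p : Fin m × Fin n, p.2.1 < n := fun p => p.2.2
  simp only [Has3Chain, Has2Chain, Admissible, idxMS, Multiset.mem_filter, Multiset.mem_map,
    Finset.forall_mem_map, Multiset.mem_toFinset, cellEmb_apply]
  constructor
  · rintro ⟨h3, h4⟩
    refine ⟨fun a _ => h1 a, fun a _ _ => h1 a, fun a ha b hb hab hab' => ⟨h1 a, ?_⟩,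
      fun a ha b hb c hc hab hbc hab' hbc' => ?_⟩
    · by_contra hK
      have := h2 a
      have := h2 b
      exact h4 ⟨_, ⟨⟨a, ha, rfl⟩, by simp only; omega⟩, _, ⟨⟨b, hb, rfl⟩, by simp only; omega⟩,
        by simp only; omega, by simp only; omega⟩
    · have := h2 a
      have := h2 b
      have := h2 c
      exact h3 ⟨_, ⟨a, ha, rfl⟩, _, ⟨b, hb, rfl⟩, _, ⟨c, hc, rfl⟩, by simp only; omega,
        by simp only; omega, by simp only; omega, by simp only; omega⟩
  · rintro ⟨-, -, h3, h4⟩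
    constructor
    · rintro ⟨_, ⟨a, ha, rfl⟩, _, ⟨b, hb, rfl⟩, _, ⟨c, hc, rfl⟩, h5, h6, h7, h8⟩
      have := h2 a
      have := h2 b
      have := h2 c
      simp only at h5 h6 h7 h8
      exact h4 a ha b hb c hc (by omega) (by omega) (by omega) (by omega)
    · rintro ⟨_, ⟨⟨a, ha, rfl⟩, h5⟩, _, ⟨⟨b, hb, rfl⟩, h6⟩, h7, h8⟩
      have := h2 a
      have := h2 b
      simp only at h5 h6 h7 h8
      have := (h3 a ha b hb (by omega) (by omega)).2
      omega

theorem mk_P1_eq_admWeight {m n ξ : ℕ} (hξn : ξ ≤ n) :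
    PowerSeries.mk (fun r => (P1 m n ξ r : ℚ)) =
      admWeight (PowerSeries.X * PowerSeries.mk (fun _ => (1 : ℚ))) (n - ξ + 1)
        (stair m n 0) m m := by
  classical
  simp only [P1, chain_conditions_iff_admissible hξn]
  rw [← map_cellEmb_univ, admWeight]
  have key := mk_card_sym fun T : Finset (Fin m × Fin n) =>
    Admissible (n - ξ + 1) m m (T.map (cellEmb m n))
  refine key.trans (Finset.sum_bij
    (fun (T : Finset (Fin m × Fin n)) _ => T.map (cellEmb m n)) ?_ ?_ ?_ ?_)
  · intro T _
    exact Finset.mem_powerset.2 (Finset.map_subset_map.2 (Finset.subset_univ T))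
  · intro S _ T _ h
    exact Finset.map_injective _ h
  · intro T hT
    obtain ⟨S, -, rfl⟩ := Finset.subset_map_iff.1 (Finset.mem_powerset.1 hT)
    exact ⟨S, Finset.mem_univ _, rfl⟩
  · intro T _
    rw [Finset.card_map]

/-- Proposition 2.1 (special case) of the paper: closed form of the generating function
of `P1` in `ℚ⟦t⟧`. -/
theorem P1_genFun (m n ξ : ℕ) (hm : 2 ≤ m) (hn : 2 ≤ n) (hξ1 : 1 ≤ ξ) (hξn : ξ ≤ n) :
    (1 - PowerSeries.X : PowerSeries ℚ) ^ (2 * m + 2 * n - ξ - 2) *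
        PowerSeries.mk (fun r => (P1 m n ξ r : ℚ)) =
      PowerSeries.mk (fun r => ((Nat.choose (m - 2) r * Nat.choose (n - ξ) r : ℕ) : ℚ)) *
        PowerSeries.mk (fun r => ((Nat.choose (m - 1) r * Nat.choose (n - 1) r : ℕ) : ℚ)) -
      PowerSeries.mk (fun r => if r = 0 then 0 else
          ((Nat.choose (m - 1) r * Nat.choose (n - 2) (r - 1) : ℕ) : ℚ)) *
        PowerSeries.mk (fun r =>
          ((Nat.choose (m - 2) r * Nat.choose (n - ξ + 1) (r + 1) : ℕ) : ℚ)) := by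
  obtain ⟨μ, rfl⟩ := Nat.exists_eq_add_of_le' hm
  obtain ⟨ν, rfl⟩ := Nat.exists_eq_add_of_le' hn
  obtain ⟨κ, hκ⟩ : ∃ κ, κ = ν + 2 - ξ := ⟨_, rfl⟩
  have hx : PowerSeries.mk (fun _ => (1 : ℚ)) * (1 - PowerSeries.X) = 1 :=
    PowerSeries.mk_one_mul_one_sub_eq_one ℚ
  rw [mk_P1_eq_admWeight hξn, admWeight_stair_of_ge hx (by omega) (by omega) le_rfl (by omega)
    le_rfl, ← hκ, show 2 * (μ + 2) + 2 * (ν + 2) - ξ - 2 = 2 * μ + ν + κ + 4 by omega,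
    pow_mul_pairDet hx, choosePoly_sub_right]
  rfl
end
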